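/- arXiv:1802.02420 — 2 statements merged into one kernel-verified Lean document; each statement's English description precedes it below -/
import Mathlib

section
/- For every n ≥ 1, the free idempotent generated semigroups IG(E(T_n)) and IG(E(PT_n)) have decidable word problems; that is, with E = E(T_n) (respectively E = E(PT_n)), the set {(u, v) ∈ E⁺ × E⁺ : ū = v̄ in IG(E)} is a computable (decidable) set. -/
section Green

variable {T : Type*} [Semigroup T]

/-- Green's relation 𝓡. -/
def GreenR (a b : T) : Prop := a = b ∨ ∃ x y : T, a * x = b ∧ b * y = a

/-- Green's relation 𝓛. -/
def GreenL (a b : T) : Prop := a = b ∨ ∃ x y : T, x * a = b ∧ y * b = a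

/-- Green's relation 𝓓 = 𝓡 ∘ 𝓛. -/
def GreenD (a b : T) : Prop := ∃ c : T, GreenR a c ∧ GreenL c b

/-- An element is regular if `a = a * b * a` for some `b`. -/
def IsRegularElem (a : T) : Prop := ∃ b : T, a * b * a = a

/-- The principal two-sided ideal `T¹ a T¹`. -/
def principalIdeal (a : T) : Set T :=
  {x | x = a ∨ (∃ u, u * a = x) ∨ (∃ v, a * v = x) ∨ ∃ u v, u * a * v = x}

/-- Green's relation 𝓙. -/
def GreenJ (a b : T) : Prop := principalIdeal a = principalIdeal b

/-- The 𝓙-preorder. -/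
def JleRel (a b : T) : Prop := principalIdeal a ⊆ principalIdeal b

/-- Strict 𝓙-order. -/
def JltRel (a b : T) : Prop := JleRel a b ∧ ¬ JleRel b a

/-- `u` is a (two-sided) identity element. -/
def IsIdentityElem (u : T) : Prop := ∀ x : T, u * x = x ∧ x * u = x

/-- The relation 𝓡̃. -/
def RTilde (a b : T) : Prop := ∀ ε : T, ε * ε = ε → (ε * a = a ↔ ε * b = b)

/-- The relation 𝓛̃. -/
def LTilde (a b : T) : Prop := ∀ ε : T, ε * ε = ε → (a * ε = a ↔ b * ε = b)

/-- `blockProd p i k = p i * p (i+1) * ⋯ * p (i+k)`. -/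
def blockProd (p : ℕ → T) (i : ℕ) : ℕ → T
  | 0 => p i
  | k + 1 => blockProd p i k * p (i + (k + 1))

/-- Multiply `x` by optional (possibly empty) words on both sides. -/
def withCtx (u : Option T) (x : T) (v : Option T) : T :=
  match u, v with
  | none, none => x
  | some u', none => u' * x
  | none, some v' => x * v'
  | some u', some v' => u' * x * v'

/-- Multiply by an optional word on the left. -/
def leftCtx (u : Option T) (x : T) : T := match u with | none => x | some u' => u' * x

/-- Multiply by an optional word on the right. -/
def rightCtx (x : T) (v : Option T) : T := match v with | none => x | some v' => x * v'

end Green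

section IGdef

/-- The set of idempotents of `S`. -/
abbrev IdemE (S : Type*) [Semigroup S] : Type _ := {x : S // x * x = x}

variable {S : Type*} [Semigroup S]

/-- `e, f` form a basic pair if `{e,f} ∩ {ef,fe} ≠ ∅`. -/
def BasicPair (e f : IdemE S) : Prop :=
  (e : S) * f = e ∨ (e : S) * f = f ∨ (f : S) * e = e ∨ (f : S) * e = f

/-- The defining relations of IG(E): `ef = g` whenever `e, f` is a basic pair with
product `g` in `S`. -/
def igRelBase (u v : FreeSemigroup (IdemE S)) : Prop :=
  ∃ e f g : IdemE S, BasicPair e f ∧ (g : S) = (e : S) * (f : S) ∧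
    u = FreeSemigroup.of e * FreeSemigroup.of f ∧ v = FreeSemigroup.of g

/-- The congruence on the free semigroup `E⁺` generated by the defining relations. -/
def igCon (S : Type*) [Semigroup S] : Con (FreeSemigroup (IdemE S)) :=
  conGen (fun u v => igRelBase u v)

/-- The free idempotent generated semigroup IG(E). -/
abbrev IG (S : Type*) [Semigroup S] := (igCon S).Quotient

/-- `w̄`, the image of a word `w ∈ E⁺` in IG(E). -/
def igBar (w : FreeSemigroup (IdemE S)) : IG S := (w : (igCon S).Quotient)

/-- The list of letters of a word. -/
def wordList (w : FreeSemigroup (IdemE S)) : List (IdemE S) := w.head :: w.tail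

/-- The length of a word. -/
def wlen (w : FreeSemigroup (IdemE S)) : ℕ := (wordList w).length

/-- Length of an optional word. -/
def olen (u : Option (FreeSemigroup (IdemE S))) : ℕ :=
  match u with | none => 0 | some u' => wlen u'

/-- `p 1, …, p m` is an r-factorisation of `w`: each factor represents a regular
element of IG(E). -/
def IsRFact (w : FreeSemigroup (IdemE S)) (m : ℕ) (p : ℕ → FreeSemigroup (IdemE S)) : Prop :=
  1 ≤ m ∧ blockProd p 1 (m - 1) = w ∧ ∀ i, 1 ≤ i → i ≤ m → IsRegularElem (igBar (p i))

/-- A minimal r-factorisation: no product of two or more consecutive factors is regular. -/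
def IsMinRFact (w : FreeSemigroup (IdemE S)) (m : ℕ) (p : ℕ → FreeSemigroup (IdemE S)) : Prop :=
  IsRFact w m p ∧
    ∀ i j, 1 ≤ i → i < j → j ≤ m → ¬ IsRegularElem (igBar (blockProd p i (j - i)))

/-- The relation ≈ on m-tuples of words. -/
def TupleApprox (m : ℕ) (p q : ℕ → FreeSemigroup (IdemE S)) : Prop :=
  (∃ i, 1 ≤ i ∧ i ≤ m ∧ igBar (p i) = igBar (q i) ∧
    ∀ j, 1 ≤ j → j ≤ m → j ≠ i → p j = q j) ∨
  (∃ i, ∃ e : IdemE S, 1 ≤ i ∧ i < m ∧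
    igBar (p i) = igBar (q i * FreeSemigroup.of e) ∧
    igBar (q (i + 1)) = igBar (FreeSemigroup.of e * p (i + 1)) ∧
    ∀ j, 1 ≤ j → j ≤ m → j ≠ i → j ≠ i + 1 → p j = q j) ∨
  (∃ i, ∃ e : IdemE S, 1 ≤ i ∧ i < m ∧
    igBar (q i) = igBar (p i * FreeSemigroup.of e) ∧
    igBar (p (i + 1)) = igBar (FreeSemigroup.of e * q (i + 1)) ∧
    ∀ j, 1 ≤ j → j ≤ m → j ≠ i → j ≠ i + 1 → p j = q j)

/-- The relation ∼: the transitive closure of ≈. -/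
def TupleSim (m : ℕ) (p q : ℕ → FreeSemigroup (IdemE S)) : Prop :=
  Relation.TransGen (TupleApprox m) p q

/-- One application of a defining relation of IG(E) inside a word. -/
def RewriteStep (w w' : FreeSemigroup (IdemE S)) : Prop :=
  ∃ (u v : Option (FreeSemigroup (IdemE S))) (x y : FreeSemigroup (IdemE S)),
    (igRelBase x y ∨ igRelBase y x) ∧ w = withCtx u x v ∧ w' = withCtx u y v

/-- `e` is a seed of `w` at (1-based) position `k`. -/
def SeedAt (w : FreeSemigroup (IdemE S)) (e : IdemE S) (k : ℕ) : Prop :=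
  ∃ u v : Option (FreeSemigroup (IdemE S)),
    w = withCtx u (FreeSemigroup.of e) v ∧ k = olen u + 1 ∧
    GreenL (igBar (leftCtx u (FreeSemigroup.of e))) (igBar (FreeSemigroup.of e)) ∧
    GreenR (igBar (FreeSemigroup.of e)) (igBar (rightCtx (FreeSemigroup.of e) v))

/-- The coordinate (position within `w` of the first letter) of the `i`-th factor. -/
def wcoord (p : ℕ → FreeSemigroup (IdemE S)) (i : ℕ) : ℕ :=
  1 + ∑ j ∈ Finset.Ico 1 i, wlen (p j)

end IGdef

/-- The full transformation monoid on `Fin n`. -/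
abbrev Tn (n : ℕ) := Function.End (Fin n)

/-- The monoid of partial transformations on `Fin n`, realised as the maps on
`Option (Fin n)` sending `none` (the "undefined" point) to `none`. -/
def PTn (n : ℕ) : Submonoid (Function.End (Option (Fin n))) where
  carrier := {f | f none = none}
  mul_mem' := by
    intro a b ha hb
    simp only [Set.mem_setOf_eq] at *
    show a (b none) = none
    rw [hb, ha]
  one_mem' := rfl

/-- Encode a word over `E` as a list over `Fin k`, via a bijection `ι : E ≃ Fin k`. -/
def encodeWord {S : Type*} [Semigroup S] {k : ℕ} (ι : IdemE S ≃ Fin k)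
    (w : FreeSemigroup (IdemE S)) : List (Fin k) := (wordList w).map ι

namespace IGWord

open Relation

section Rewriting

variable {X : Type*}

/-- Apply a length-reducing rule `x y ⟶ z` somewhere in a word. -/
inductive Red (R : X → X → X → Prop) : List X → List X → Prop
  | head {x y z : X} {w : List X} : R x y z → Red R (x :: y :: w) (z :: w)
  | tail {x : X} {w w' : List X} : Red R w w' → Red R (x :: w) (x :: w')

/-- Apply a length-preserving rule `x y ⟶ x' y'` somewhere in a word. -/
inductive Move (T : X → X → X → X → Prop) : List X → List X → Prop
  | head {x y x' y' : X} {w : List X} : T x y x' y' → Move T (x :: y :: w) (x' :: y' :: w)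
  | tail {x : X} {w w' : List X} : Move T w w' → Move T (x :: w) (x :: w')

/-- The critical pairs of a system of length-reducing rules `R` and length-preserving rules `T`
are resolvable. -/
structure CriticalPairs (R : X → X → X → Prop) (T : X → X → X → X → Prop) : Prop where
  symm : ∀ {x y x' y'}, T x y x' y' → T x' y' x y
  det : ∀ {x y z z'}, R x y z → R x y z' → z = z'
  red_red : ∀ {x y z t s}, R x y t → R y z s → T t z x s ∨ ∃ c, R t z c ∧ R x s c
  red_move : ∀ {x y z x' y'}, R x y z → T x y x' y' → R x' y' z
  red_move_right : ∀ {x y z t y' z'}, R x y t → T y z y' z' → ∃ t', R x y' t' ∧ T t z t' z'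
  red_move_left : ∀ {x y z s x' y'}, R y z s → T x y x' y' → ∃ s', R y' z s' ∧ T x s x' s'

variable {R : X → X → X → Prop} {T : X → X → X → X → Prop}

/-- A single rewriting step, of either kind. -/
def Step (R : X → X → X → Prop) (T : X → X → X → X → Prop) (u v : List X) : Prop :=
  Red R u v ∨ Move T u v

lemma Red.length {u v : List X} (h : Red R u v) : u.length = v.length + 1 := by
  induction h with
  | head _ => simp
  | tail _ ih => simp [ih]

lemma Move.length {u v : List X} (h : Move T u v) : u.length = v.length := by
  induction h with
  | head _ => simp
  | tail _ ih => simp [ih]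

lemma Step.cons {u v : List X} (x : X) (h : Step R T u v) : Step R T (x :: u) (x :: v) :=
  h.imp .tail .tail

lemma Step.append_right {u v : List X} (w : List X) (h : Step R T u v) :
    Step R T (u ++ w) (v ++ w) := by
  rcases h with h | h
  · left
    induction h with
    | head h => exact .head h
    | tail _ ih => exact .tail ih
  · right
    induction h with
    | head h => exact .head h
    | tail _ ih => exact .tail ih

lemma Step.append_left {u v : List X} (w : List X) (h : Step R T u v) :
    Step R T (w ++ u) (w ++ v) := by
  induction w with
  | nil => exact h
  | cons x w ih => exact ih.cons x

/-- Two words with a common descendant. -/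
def Joinable (R : X → X → X → Prop) (T : X → X → X → X → Prop) (u v : List X) : Prop :=
  ∃ w, ReflTransGen (Step R T) u w ∧ ReflTransGen (Step R T) v w

lemma Joinable.symm {u v : List X} (h : Joinable R T u v) : Joinable R T v u := by
  obtain ⟨w, h1, h2⟩ := h
  exact ⟨w, h2, h1⟩

lemma Joinable.cons {u v : List X} (x : X) (h : Joinable R T u v) :
    Joinable R T (x :: u) (x :: v) := by
  obtain ⟨w, h1, h2⟩ := h
  have key : ∀ {a}, ReflTransGen (Step R T) a w → ReflTransGen (Step R T) (x :: a) (x :: w) :=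
    fun h => ReflTransGen.lift (x :: ·) (fun _ _ => Step.cons x) _ _ h
  exact ⟨x :: w, key h1, key h2⟩

namespace CriticalPairs

variable (H : CriticalPairs R T)
include H

lemma move_symm {u v : List X} (h : Move T u v) : Move T v u := by
  induction h with
  | head h => exact .head (H.symm h)
  | tail _ ih => exact .tail ih

lemma joinable_of_red_of_red {w a b : List X} (ha : Red R w a) (hb : Red R w b) :
    Joinable R T a b := by
  induction ha generalizing b with
  | @head x y z w h =>
    cases hb with
    | head h' => rw [H.det h h']; exact ⟨_, .refl, .refl⟩
    | tail h' =>
      cases h' with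
      | head h' =>
        rcases H.red_red h h' with h | ⟨c, h1, h2⟩
        · exact ⟨_, .single (Or.inr (.head h)), .refl⟩
        · exact ⟨_, .single (Or.inl (.head h1)), .single (Or.inl (.head h2))⟩
      | tail h' => exact ⟨_, .single (Or.inl (.tail h')), .single (Or.inl (.head h))⟩
  | @tail x w w' h ih =>
    cases hb with
    | head h' =>
      cases h with
      | head h =>
        rcases H.red_red h' h with h | ⟨c, h1, h2⟩
        · exact ⟨_, .refl, .single (Or.inr (.head h))⟩
        · exact ⟨_, .single (Or.inl (.head h2)), .single (Or.inl (.head h1))⟩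
      | tail h => exact ⟨_, .single (Or.inl (.head h')), .single (Or.inl (.tail h))⟩
    | tail h' => exact (ih h').cons x

lemma exists_red_of_red_of_move {w a b : List X} (ha : Red R w a) (hb : Move T w b) :
    ∃ c, Red R b c ∧ ReflTransGen (Move T) a c := by
  induction ha generalizing b with
  | @head x y z w h =>
    cases hb with
    | head h' => exact ⟨_, .head (H.red_move h h'), .refl⟩
    | tail h' =>
      cases h' with
      | head h' =>
        obtain ⟨t, h1, h2⟩ := H.red_move_right h h'
        exact ⟨_, .head h1, .single (.head h2)⟩
      | tail h' => exact ⟨_, .head h, .single (.tail h')⟩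
  | @tail x w w' h ih =>
    cases hb with
    | head h' =>
      cases h with
      | head h =>
        obtain ⟨t, h1, h2⟩ := H.red_move_left h h'
        exact ⟨_, .tail (.head h1), .single (.head h2)⟩
      | tail h => exact ⟨_, .tail (.tail h), .single (.head h')⟩
    | tail h' =>
      obtain ⟨c, h1, h2⟩ := ih h'
      exact ⟨x :: c, .tail h1, ReflTransGen.lift (x :: ·) (fun _ _ => .tail) _ _ h2⟩

lemma exists_red_of_red_of_moves {w a b : List X} (ha : Red R w a)
    (hb : ReflTransGen (Move T) w b) : ∃ c, Red R b c ∧ ReflTransGen (Move T) a c := by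
  induction hb with
  | refl => exact ⟨a, ha, .refl⟩
  | tail _ h ih =>
    obtain ⟨c, h1, h2⟩ := ih
    obtain ⟨d, h3, h4⟩ := H.exists_red_of_red_of_move h1 h
    exact ⟨d, h3, h2.trans h4⟩

lemma moves_symm {u v : List X} (h : ReflTransGen (Move T) u v) : ReflTransGen (Move T) v u := by
  induction h with
  | refl => exact .refl
  | tail _ h ih => exact ih.head (H.move_symm h)

omit H in
lemma moves_or_red {u v : List X} (h : ReflTransGen (Step R T) u v) :
    ReflTransGen (Move T) u v ∨
      ∃ a b, ReflTransGen (Move T) u a ∧ Red R a b ∧ ReflTransGen (Step R T) b v := by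
  induction h using ReflTransGen.head_induction_on with
  | refl => exact Or.inl .refl
  | head h h' ih =>
    rcases h with h | h
    · exact Or.inr ⟨_, _, .refl, h, h'⟩
    · rcases ih with ih | ⟨a, b, h1, h2, h3⟩
      · exact Or.inl (ih.head h)
      · exact Or.inr ⟨a, b, h1.head h, h2, h3⟩

omit H in
lemma steps_of_moves {u v : List X} (h : ReflTransGen (Move T) u v) :
    ReflTransGen (Step R T) u v := by
  induction h with
  | refl => exact .refl
  | tail _ h ih => exact ih.tail (Or.inr h)

omit H in
lemma moves_length {u v : List X} (h : ReflTransGen (Move T) u v) : u.length = v.length := by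
  induction h with
  | refl => rfl
  | tail _ h ih => rw [ih, h.length]

lemma confluent {w a b : List X} (ha : ReflTransGen (Step R T) w a)
    (hb : ReflTransGen (Step R T) w b) : Joinable R T a b := by
  induction hn : w.length using Nat.strong_induction_on generalizing w a b with
  | _ n IH =>
    rcases moves_or_red ha with h | ⟨a1, a2, h1, h2, h3⟩
    · exact ⟨b, (steps_of_moves (H.moves_symm h)).trans hb, .refl⟩
    rcases moves_or_red hb with h | ⟨b1, b2, h1', h2', h3'⟩
    · exact ⟨a, .refl, (steps_of_moves (H.moves_symm h)).trans ha⟩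
    obtain ⟨c, hc, hac⟩ := H.exists_red_of_red_of_moves h2 ((H.moves_symm h1).trans h1')
    have e1 := moves_length h1
    have e2 := moves_length h1'
    have e3 := h2.length
    have e4 := h2'.length
    obtain ⟨d, hd, hd'⟩ := H.joinable_of_red_of_red hc h2'
    obtain ⟨p, hp, hp'⟩ := IH _ (by omega) h3 ((steps_of_moves hac).trans hd) rfl
    obtain ⟨q, hq, hq'⟩ := IH _ (by omega) (hd'.trans hp') h3' rfl
    exact ⟨q, hp.trans hq, hq'⟩

lemma joinable_of_eqvGen {u v : List X} (h : EqvGen (Step R T) u v) : Joinable R T u v := by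
  induction h with
  | rel _ _ h => exact ⟨_, .single h, .refl⟩
  | refl _ => exact ⟨_, .refl, .refl⟩
  | symm _ _ _ ih => exact ih.symm
  | trans _ _ _ _ _ ih1 ih2 =>
    obtain ⟨w1, h1, h2⟩ := ih1
    obtain ⟨w2, h3, h4⟩ := ih2
    obtain ⟨w, h5, h6⟩ := H.confluent h2 h3
    exact ⟨w, h1.trans h5, h4.trans h6⟩

end CriticalPairs

end Rewriting

section Green

variable {M : Type*} [Semigroup M]

/-- Green's relation 𝓡 restricted to `B`, extended by the identity relation. -/
def RhoOn (B : Set M) (a b : M) : Prop := a = b ∨ a ∈ B ∧ b ∈ B ∧ ∃ g h, a * g = b ∧ b * h = a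

/-- Green's relation 𝓛 restricted to `B`, extended by the identity relation. -/
def LamOn (B : Set M) (a b : M) : Prop := a = b ∨ a ∈ B ∧ b ∈ B ∧ ∃ g h, g * a = b ∧ h * b = a

/-- `B` is a union of 𝓡-classes and a union of 𝓛-classes, and products of elements of `B` with
elements of `X` that stay inside `X` lie in `B`. -/
structure GreenClosed (X B : Set M) : Prop where
  subset : B ⊆ X
  right : ∀ a ∈ B, ∀ g h, a * g * h = a → a * g ∈ B
  left : ∀ a ∈ B, ∀ g h, h * (g * a) = a → g * a ∈ B
  mul_right : ∀ x ∈ X, ∀ y ∈ B, x * y ∈ X → x * y ∈ B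
  mul_left : ∀ x ∈ X, ∀ y ∈ B, y * x ∈ X → y * x ∈ B

variable {X B : Set M}

lemma RhoOn.symm {a b : M} (h : RhoOn B a b) : RhoOn B b a := by
  rcases h with h | ⟨ha, hb, g, k, h1, h2⟩
  · exact Or.inl h.symm
  · exact Or.inr ⟨hb, ha, k, g, h2, h1⟩

lemma LamOn.symm {a b : M} (h : LamOn B a b) : LamOn B b a := by
  rcases h with h | ⟨ha, hb, g, k, h1, h2⟩
  · exact Or.inl h.symm
  · exact Or.inr ⟨hb, ha, k, g, h2, h1⟩

lemma RhoOn.trans {a b c : M} (h : RhoOn B a b) (h' : RhoOn B b c) : RhoOn B a c := by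
  rcases h with rfl | ⟨ha, hb, g, k, h1, h2⟩
  · exact h'
  rcases h' with rfl | ⟨_, hc, g', k', h1', h2'⟩
  · exact Or.inr ⟨ha, hb, g, k, h1, h2⟩
  · refine Or.inr ⟨ha, hc, g * g', k' * k, ?_, ?_⟩
    · rw [← mul_assoc, h1, h1']
    · rw [← mul_assoc, h2', h2]

lemma LamOn.trans {a b c : M} (h : LamOn B a b) (h' : LamOn B b c) : LamOn B a c := by
  rcases h with rfl | ⟨ha, hb, g, k, h1, h2⟩
  · exact h'
  rcases h' with rfl | ⟨_, hc, g', k', h1', h2'⟩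
  · exact Or.inr ⟨ha, hb, g, k, h1, h2⟩
  · refine Or.inr ⟨ha, hc, g' * g, k * k', ?_, ?_⟩
    · rw [mul_assoc, h1, h1']
    · rw [mul_assoc, h2', h2]

lemma GreenClosed.rho_mul (H : GreenClosed X B) {x y y' : M} (hx : x ∈ X) (h : RhoOn B y y')
    (hxy : x * y ∈ X) : x * y' ∈ X ∧ RhoOn B (x * y) (x * y') := by
  rcases h with rfl | ⟨hy, hy', g, k, rfl, h2⟩
  · exact ⟨hxy, Or.inl rfl⟩
  have h1 : x * y ∈ B := H.mul_right _ hx _ hy hxy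
  have h3 : x * y * g * k = x * y := by rw [mul_assoc, mul_assoc, ← mul_assoc y, h2]
  have h4 := H.right _ h1 g k h3
  rw [← mul_assoc]
  exact ⟨H.subset h4, Or.inr ⟨h1, h4, g, k, rfl, h3⟩⟩

lemma GreenClosed.lam_mul (H : GreenClosed X B) {x y y' : M} (hx : x ∈ X) (h : LamOn B y y')
    (hxy : y * x ∈ X) : y' * x ∈ X ∧ LamOn B (y * x) (y' * x) := by
  rcases h with rfl | ⟨hy, hy', g, k, rfl, h2⟩
  · exact ⟨hxy, Or.inl rfl⟩
  have h1 : y * x ∈ B := H.mul_left _ hx _ hy hxy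
  have h3 : k * (g * (y * x)) = y * x := by rw [← mul_assoc g, ← mul_assoc k, h2]
  have h4 := H.left _ h1 g k h3
  rw [mul_assoc]
  exact ⟨H.subset h4, Or.inr ⟨h1, h4, g, k, rfl, h3⟩⟩

/-- The length-reducing rules on `X`. -/
def RedRule (X B : Set M) (x y z : X) : Prop :=
  (z : M) = x * y ∧ (RhoOn B (x : M) z ∨ LamOn B (y : M) z)

/-- Transfer of a middle factor from left to right. -/
def Transfer (X B : Set M) (x y x' y' : X) : Prop :=
  ∃ m : M, (x : M) = x' * m ∧ (y' : M) = m * y ∧ RhoOn B (x : M) x' ∧ LamOn B (y : M) y'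

/-- The length-preserving rules on `X`. -/
def MoveRule (X B : Set M) (x y x' y' : X) : Prop :=
  Transfer X B x y x' y' ∨ Transfer X B x' y' x y

lemma GreenClosed.criticalPairs (H : GreenClosed X B) :
    CriticalPairs (RedRule X B) (MoveRule X B) where
  symm h := h.symm
  det h h' := Subtype.ext (h.1.trans h'.1.symm)
  red_red := by
    rintro x y z t s ⟨ht, ht'⟩ ⟨hs, hs'⟩
    have hxy : (x : M) * y ∈ X := ht ▸ t.2
    have hyz : (y : M) * z ∈ X := hs ▸ s.2
    rcases hs' with hs' | hs'
    · obtain ⟨h1, h2⟩ := H.rho_mul x.2 hs' hxy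
      rw [← ht] at h2
      refine Or.inr ⟨⟨_, h1⟩, ⟨?_, Or.inl h2⟩, rfl, ?_⟩
      · simp only [hs, ht, mul_assoc]
      · rcases ht' with ht' | ht'
        · exact Or.inl (ht'.trans h2)
        · obtain ⟨h3, h4⟩ := H.lam_mul z.2 ht' hyz
          right
          simpa only [hs, ht, mul_assoc] using h4
    rcases ht' with ht' | ht'
    · exact Or.inl (Or.inl ⟨y, ht, hs, ht'.symm, hs'⟩)
    · obtain ⟨h1, h2⟩ := H.lam_mul z.2 ht' hyz
      rw [← hs] at h2
      refine Or.inr ⟨⟨_, h1⟩, ⟨rfl, Or.inr (hs'.trans h2)⟩, ?_, Or.inr h2⟩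
      simp only [hs, ht, mul_assoc]
  red_move := by
    rintro x y z x' y' ⟨hz, hz'⟩ (⟨m, h1, h2, h3, h4⟩ | ⟨m, h1, h2, h3, h4⟩)
    · refine ⟨?_, hz'.imp h3.symm.trans h4.symm.trans⟩
      rw [hz, h1, h2, mul_assoc]
    · refine ⟨?_, hz'.imp h3.trans h4.trans⟩
      rw [hz, h1, h2, mul_assoc]
  red_move_right := by
    rintro x y z t y' z' ⟨ht, ht'⟩ h
    have hxy : (x : M) * y ∈ X := ht ▸ t.2
    have hrho : RhoOn B (y : M) y' := by
      rcases h with ⟨m, h1, h2, h3, h4⟩ | ⟨m, h1, h2, h3, h4⟩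
      exacts [h3, h3.symm]
    obtain ⟨h5, h6⟩ := H.rho_mul x.2 hrho hxy
    refine ⟨⟨_, h5⟩, ⟨rfl, ?_⟩, ?_⟩
    · rcases ht' with ht' | ht'
      · rw [← ht] at h6
        exact Or.inl (ht'.trans h6)
      · right
        rw [ht] at ht'
        rcases hrho with hrho | ⟨hy, hy', g, k, hg, hk⟩
        · change LamOn B (y' : M) (x * y')
          rwa [← hrho]
        · rcases ht' with ht' | ⟨_, _, g', k', hg', hk'⟩
          · left
            change (y' : M) = x * y'
            rw [← hg, ← mul_assoc, ← ht']
          · refine Or.inr ⟨hy', H.mul_right _ x.2 _ hy' h5, x, k', rfl, ?_⟩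
            change k' * ((x : M) * y') = y'
            rw [← hg, ← mul_assoc (x : M), ← mul_assoc, hk']
    · rw [← ht] at h6
      rcases h with ⟨m, h1, h2, h3, h4⟩ | ⟨m, h1, h2, h3, h4⟩
      · refine Or.inl ⟨m, ?_, h2, h6, h4⟩
        change (t : M) = x * y' * m
        rw [ht, h1, mul_assoc]
      · refine Or.inr ⟨m, ?_, h2, h6.symm, h4⟩
        change (x : M) * y' = t * m
        rw [ht, h1, mul_assoc]
  red_move_left := by
    rintro x y z s x' y' ⟨hs, hs'⟩ h
    have hyz : (y : M) * z ∈ X := hs ▸ s.2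
    have hlam : LamOn B (y : M) y' := by
      rcases h with ⟨m, h1, h2, h3, h4⟩ | ⟨m, h1, h2, h3, h4⟩
      exacts [h4, h4.symm]
    obtain ⟨h5, h6⟩ := H.lam_mul z.2 hlam hyz
    refine ⟨⟨_, h5⟩, ⟨rfl, ?_⟩, ?_⟩
    · rcases hs' with hs' | hs'
      · left
        rw [hs] at hs'
        rcases hlam with hlam | ⟨hy, hy', g, k, hg, hk⟩
        · change RhoOn B (y' : M) (y' * z)
          rwa [← hlam]
        · rcases hs' with hs' | ⟨_, _, g', k', hg', hk'⟩
          · left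
            change (y' : M) = y' * z
            rw [← hg, mul_assoc, ← hs']
          · refine Or.inr ⟨hy', H.mul_left _ z.2 _ hy' h5, z, k', rfl, ?_⟩
            change (y' : M) * z * k' = y'
            rw [← hg, mul_assoc g, mul_assoc, hk']
      · rw [← hs] at h6
        exact Or.inr (hs'.trans h6)
    · rw [← hs] at h6
      rcases h with ⟨m, h1, h2, h3, h4⟩ | ⟨m, h1, h2, h3, h4⟩
      · refine Or.inl ⟨m, h1, ?_, h3, h6⟩
        change (y' : M) * z = m * s
        rw [hs, h2, mul_assoc]
      · refine Or.inr ⟨m, h1, ?_, h3, h6.symm⟩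
        change (s : M) = m * (y' * z)
        rw [hs, h2, mul_assoc]

end Green

section Cocycle

variable {α Ω M : Type*}

/-- Injections `α → Ω` that agree with `c` outside `D₀`. -/
def Cfg (c : α → Ω) (D₀ : Finset α) (i : α → Ω) : Prop :=
  Function.Injective i ∧ ∀ a ∉ D₀, i a = c a

/-- Two maps that take a common value only at a common argument. -/
def Compat (i j : α → Ω) : Prop := ∀ a b, i a = j b → a = b

/-- Two maps that agree outside `D`. -/
def Agree (D : Finset α) (i j : α → Ω) : Prop := ∀ a ∉ D, i a = j a

/-- Arrows `t i j`, given for compatible configurations `i`, `j`, that compose functorially as long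
as the three configurations involved are pairwise compatible, and satisfy a property `P`. -/
structure LocalSystem [Mul M] (c : α → Ω) (D₀ : Finset α) (t : (α → Ω) → (α → Ω) → M)
    (P : (α → Ω) → (α → Ω) → M → Prop) : Prop where
  comp : ∀ {i j k}, Cfg c D₀ i → Cfg c D₀ j → Cfg c D₀ k → Compat i j → Compat j k → Compat i k →
    t j k * t i j = t i k
  prop : ∀ {i j}, Cfg c D₀ i → Cfg c D₀ j → Compat i j → P i j (t i j)
  prop_mul : ∀ {i j k m m'}, Cfg c D₀ i → Cfg c D₀ j → Cfg c D₀ k → P i j m → P j k m' →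
    P i k (m' * m)

/-- A functorial extension of a local system to all pairs of configurations that agree
outside `D`. -/
structure Extension [Mul M] (c : α → Ω) (D₀ D : Finset α) (t : (α → Ω) → (α → Ω) → M)
    (P : (α → Ω) → (α → Ω) → M → Prop) (u : (α → Ω) → (α → Ω) → M) : Prop where
  eq : ∀ {i j}, Cfg c D₀ i → Cfg c D₀ j → Agree D i j → Compat i j → u i j = t i j
  comp : ∀ {i j k}, Cfg c D₀ i → Cfg c D₀ j → Cfg c D₀ k → Agree D i j → Agree D j k →
    u j k * u i j = u i k
  prop : ∀ {i j}, Cfg c D₀ i → Cfg c D₀ j → Agree D i j → P i j (u i j)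

lemma Compat.symm {i j : α → Ω} (h : Compat i j) : Compat j i :=
  fun a b hab => (h b a hab.symm).symm

lemma Agree.symm {D : Finset α} {i j : α → Ω} (h : Agree D i j) : Agree D j i :=
  fun a ha => (h a ha).symm

lemma Agree.trans {D : Finset α} {i j k : α → Ω} (h : Agree D i j) (h' : Agree D j k) :
    Agree D i k :=
  fun a ha => (h a ha).trans (h' a ha)

lemma Cfg.compat_self {c : α → Ω} {D₀ : Finset α} {i : α → Ω} (h : Cfg c D₀ i) : Compat i i :=
  fun _ _ hab => h.1 hab

lemma Cfg.of_agree {c : α → Ω} {D₀ D : Finset α} {i k : α → Ω} (h : Cfg c D₀ i) (hD : D ⊆ D₀)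
    (hk : Function.Injective k) (hik : Agree D i k) : Cfg c D₀ k :=
  ⟨hk, fun a ha => (hik a fun h' => ha (hD h')).symm.trans (h.2 a ha)⟩

section Update

variable [DecidableEq α]

lemma injective_update {k : α → Ω} (hk : Function.Injective k) {a : α} {p : Ω}
    (hp : ∀ x, x ≠ a → k x ≠ p) : Function.Injective (Function.update k a p) := by
  intro x x' h
  by_cases hx : x = a <;> by_cases hx' : x' = a
  · rw [hx, hx']
  · subst hx; simp only [Function.update_self, Function.update_of_ne hx'] at h
    exact absurd h.symm (hp _ hx')
  · subst hx'; simp only [Function.update_self, Function.update_of_ne hx] at h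
    exact absurd h (hp _ hx)
  · simp only [Function.update_of_ne hx, Function.update_of_ne hx'] at h
    exact hk h

lemma compat_update {k k' : α → Ω} (hk : Compat k k') {a : α} {p : Ω}
    (hp : ∀ x, x ≠ a → k x ≠ p) : Compat k (Function.update k' a p) := by
  intro x x' h
  by_cases hx' : x' = a
  · subst hx'; rw [Function.update_self] at h
    by_contra hx
    exact hp _ hx h
  · rw [Function.update_of_ne hx'] at h
    exact hk _ _ h

lemma compat_update_update {k k' : α → Ω} (hk : Compat k k') {a : α} {p q : Ω}
    (hp : ∀ x, x ≠ a → k' x ≠ p) (hq : ∀ x, x ≠ a → k x ≠ q) :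
    Compat (Function.update k a p) (Function.update k' a q) := by
  refine fun x x' h => ?_
  by_cases hx : x = a
  · subst hx
    by_contra hx'
    rw [Function.update_self, Function.update_of_ne (Ne.symm hx')] at h
    exact hp _ (Ne.symm hx') h.symm
  · rw [Function.update_of_ne hx] at h
    exact compat_update hk hq _ _ h

variable [Fintype α] [Fintype Ω]

omit [DecidableEq α] in
lemma exists_hole (hcard : Fintype.card α + 2 ≤ Fintype.card Ω) (k : α → Ω) (y : Ω) :
    ∃ z, z ≠ y ∧ ∀ a, k a ≠ z := by
  classical
  have h : (insert y (Finset.univ.image k)).card < (Finset.univ : Finset Ω).card := by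
    have h1 := Finset.card_insert_le y (Finset.univ.image k)
    have h2 : (Finset.univ.image k).card ≤ Fintype.card α := Finset.card_image_le
    rw [Finset.card_univ]
    omega
  obtain ⟨z, -, hz⟩ := Finset.exists_mem_notMem_of_card_lt_card h
  simp only [Finset.mem_insert, Finset.mem_image, Finset.mem_univ, true_and, not_or,
    not_exists] at hz
  exact ⟨z, hz.1, hz.2⟩

lemma exists_avoiding (hcard : Fintype.card α + 2 ≤ Fintype.card Ω) (D : Finset α) {i : α → Ω}
    (hi : Function.Injective i) (y z : Ω) : ∃ k, Function.Injective k ∧ Agree D i k ∧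
      (∀ a ∈ D, k a ≠ y) ∧ ((∀ a ∈ D, i a ≠ z) → ∀ a ∈ D, k a ≠ z) := by
  by_cases h : ∃ b ∈ D, i b = y
  · obtain ⟨b, hb, rfl⟩ := h
    obtain ⟨h, hz, hh⟩ := exists_hole hcard i z
    refine ⟨Function.update i b h, injective_update hi fun x _ => hh x, ?_, ?_, ?_⟩
    · intro a ha
      rw [Function.update_of_ne]
      rintro rfl
      exact ha hb
    · intro a _
      by_cases hab : a = b
      · subst hab; rw [Function.update_self]; exact (hh a).symm
      · rw [Function.update_of_ne hab]; exact hi.ne hab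
    · intro hz' a ha
      by_cases hab : a = b
      · subst hab; rwa [Function.update_self]
      · rw [Function.update_of_ne hab]; exact hz' a ha
  · push Not at h
    exact ⟨i, hi, fun _ _ => rfl, h, id⟩

lemma exists_avoiding_pair (hcard : Fintype.card α + 2 ≤ Fintype.card Ω) (D : Finset α)
    {i : α → Ω} (hi : Function.Injective i) (y z : Ω) : ∃ k, Function.Injective k ∧ Agree D i k ∧
      (∀ a ∈ D, k a ≠ y) ∧ ∀ a ∈ D, k a ≠ z := by
  obtain ⟨k, h1, h2, h3, -⟩ := exists_avoiding hcard D hi y y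
  obtain ⟨k', h1', h2', h3', h4'⟩ := exists_avoiding hcard D h1 z y
  exact ⟨k', h1', h2.trans h2', h4' h3, h3'⟩

/-- Any two injections that agree outside `D` and whose restrictions to `D` avoid `y` are connected
by a sequence of such injections, in which consecutive terms are compatible. -/
lemma reflTransGen_compat (hcard : Fintype.card α + 2 ≤ Fintype.card Ω) (D : Finset α) (y : Ω)
    {k k' : α → Ω} (hk : Function.Injective k) (hk' : Function.Injective k')
    (hy : ∀ a ∈ D, k a ≠ y) (hy' : ∀ a ∈ D, k' a ≠ y) (hkk' : Agree D k k') :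
    ReflTransGen (fun p q => Function.Injective q ∧ Agree D p q ∧ (∀ a ∈ D, q a ≠ y) ∧ Compat p q)
      k k' := by
  classical
  induction hn : (Finset.univ.filter fun a => k a ≠ k' a).card using Nat.strong_induction_on
    generalizing k with
  | _ n IH =>
  by_cases h : k = k'
  · subst h; exact .refl
  obtain ⟨a, ha⟩ := Function.ne_iff.1 h
  have haD : a ∈ D := by
    by_contra haD
    exact ha (hkk' a haD)
  have move : ∀ q : α → Ω, Function.Injective q → (∀ a ∈ D, q a ≠ y) → Agree D k q →
      ∀ b ∈ D, ∀ p ≠ y, (∀ x, q x ≠ p) →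
      (Function.Injective (Function.update q b p) ∧ Agree D q (Function.update q b p) ∧
        (∀ a ∈ D, Function.update q b p a ≠ y) ∧ Compat q (Function.update q b p)) := by
    intro q hq hqy _ b hb p hp hqp
    refine ⟨injective_update hq fun x _ => hqp x, ?_, ?_,
      compat_update (fun _ _ h => hq h) fun x _ => hqp x⟩
    · intro x hx
      rw [Function.update_of_ne]
      rintro rfl
      exact hx hb
    · intro x hx
      by_cases hxb : x = b
      · subst hxb; rwa [Function.update_self]
      · rw [Function.update_of_ne hxb]; exact hqy x hx
  obtain ⟨q, hkq, hq, hqy, hag, hqa, hqd⟩ : ∃ q, ReflTransGen (fun p q => Function.Injective q ∧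
      Agree D p q ∧ (∀ a ∈ D, q a ≠ y) ∧ Compat p q) k q ∧ Function.Injective q ∧
      (∀ a ∈ D, q a ≠ y) ∧ Agree D k q ∧ (∀ x, q x ≠ k' a) ∧ ∀ x, k x = k' x → q x = k' x := by
    by_cases hr : ∃ b, k b = k' a
    · obtain ⟨b, hb⟩ := hr
      have hba : b ≠ a := by rintro rfl; exact ha hb
      have hbk : k b ≠ k' b := by
        intro h'
        exact hba (hk' (h'.symm.trans hb))
      have hbD : b ∈ D := by
        by_contra hbD
        exact hbk (hkk' b hbD)
      obtain ⟨z, hz, hzk⟩ := exists_hole hcard k y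
      obtain ⟨h1, h2, h3, h4⟩ := move k hk hy (fun _ _ => rfl) b hbD z hz hzk
      refine ⟨_, .single ⟨h1, h2, h3, h4⟩, h1, h3, h2, ?_, ?_⟩
      · intro x
        by_cases hxb : x = b
        · subst hxb; rw [Function.update_self, ← hb]; exact (hzk x).symm
        · rw [Function.update_of_ne hxb, ← hb]; exact hk.ne hxb
      · intro x hx
        rw [Function.update_of_ne, hx]
        rintro rfl
        exact hbk hx
    · push Not at hr
      exact ⟨k, .refl, hk, hy, fun _ _ => rfl, hr, fun _ h => h⟩
  have hstep := move q hq hqy hag a haD (k' a) (hy' a haD) hqa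
  obtain ⟨h1, h2, h3, h4⟩ := hstep
  refine (hkq.tail ⟨h1, h2, h3, h4⟩).trans
    (IH _ ?_ h1 h3 ((h2.symm.trans hag.symm).trans hkk') rfl)
  rw [← hn]
  apply Finset.card_lt_card
  refine (Finset.ssubset_iff_of_subset ?_).2 ⟨a, by simpa using ha, by simp⟩
  intro x hx
  rw [Finset.mem_filter] at hx ⊢
  refine ⟨hx.1, fun hx' => hx.2 ?_⟩
  by_cases hxa : x = a
  · subst hxa; simp
  · rw [Function.update_of_ne hxa]; exact hqd x hx'

end Update

section Extend

variable [Semigroup M] [DecidableEq α] {c : α → Ω} {D₀ D : Finset α}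
  {t : (α → Ω) → (α → Ω) → M} {P : (α → Ω) → (α → Ω) → M → Prop} {u : (α → Ω) → (α → Ω) → M}

/-- The arrow `i ⟶ k ⟶ k[d ↦ j d] ⟶ j`. -/
def detour (t u : (α → Ω) → (α → Ω) → M) (d : α) (i j k : α → Ω) : M :=
  u (Function.update k d (j d)) j * (t k (Function.update k d (j d)) * u i k)

/-- The intermediate configurations `k` for which `detour` is meaningful. -/
structure Via (D : Finset α) (d : α) (i j k : α → Ω) : Prop where
  inj : Function.Injective k
  agree : Agree D i k
  avoid : ∀ a ∈ D, k a ≠ j d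

variable {d : α} {i j l k k' : α → Ω}

lemma Via.ne (h : Via D d i j k) (hj : Function.Injective j) (hij : Agree (insert d D) i j) :
    ∀ a, a ≠ d → k a ≠ j d := by
  intro a ha
  by_cases haD : a ∈ D
  · exact h.avoid a haD
  · rw [← h.agree a haD, hij a (by simp [ha, haD])]
    exact hj.ne ha

lemma Via.agree_update (h : Via D d i j k) (hij : Agree (insert d D) i j) :
    Agree D (Function.update k d (j d)) j := by
  intro a ha
  by_cases had : a = d
  · subst had; simp
  · rw [Function.update_of_ne had, ← h.agree a ha, hij a (by simp [had, ha])]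

variable (hD : insert d D ⊆ D₀)
include hD

lemma Via.cfg (h : Via D d i j k) (hi : Cfg c D₀ i) : Cfg c D₀ k :=
  hi.of_agree ((Finset.subset_insert d D).trans hD) h.inj h.agree

lemma Via.cfg_update (h : Via D d i j k) (hj : Cfg c D₀ j) (hij : Agree (insert d D) i j) :
    Cfg c D₀ (Function.update k d (j d)) :=
  hj.of_agree ((Finset.subset_insert d D).trans hD) (injective_update h.inj (h.ne hj.1 hij))
    (h.agree_update hij).symm

lemma Extension.detour_eq_of_compat (H : LocalSystem c D₀ t P) (E : Extension c D₀ D t P u)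
    (hi : Cfg c D₀ i) (hj : Cfg c D₀ j) (hij : Agree (insert d D) i j) (hk : Via D d i j k)
    (hk' : Via D d i j k') (hc : Compat k k') : detour t u d i j k = detour t u d i j k' := by
  have hn := hk.ne hj.1 hij
  have hn' := hk'.ne hj.1 hij
  have h1 := hk.cfg hD hi
  have h1' := hk'.cfg hD hi
  have h2 := hk.cfg_update hD hj hij
  have h2' := hk'.cfg_update hD hj hij
  have hkk' : Agree D k k' := hk.agree.symm.trans hk'.agree
  have ha := hk.agree_update hij
  have ha' := hk'.agree_update hij
  have haa := ha.trans ha'.symm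
  have c1 := compat_update_update hc hn' hn
  have c2 := compat_update hc hn
  unfold detour
  rw [← E.comp h2 h2' hj haa ha', ← E.comp hi h1 h1' hk.agree hkk', E.eq h2 h2' haa c1,
    E.eq h1 h1' hkk' hc, mul_assoc, ← mul_assoc (t (Function.update k d (j d)) _),
    ← mul_assoc (t k' _),
    H.comp h1 h2 h2' (compat_update h1.compat_self hn) c1 c2,
    H.comp h1 h1' h2' hc (compat_update h1'.compat_self hn') c2]

variable [Fintype α] [Fintype Ω]

lemma Extension.detour_eq (hcard : Fintype.card α + 2 ≤ Fintype.card Ω) (H : LocalSystem c D₀ t P)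
    (E : Extension c D₀ D t P u)
    (hi : Cfg c D₀ i) (hj : Cfg c D₀ j) (hij : Agree (insert d D) i j) (hk : Via D d i j k)
    (hk' : Via D d i j k') : detour t u d i j k = detour t u d i j k' := by
  have h := reflTransGen_compat hcard D (j d) hk.inj hk'.inj hk.avoid hk'.avoid
    (hk.agree.symm.trans hk'.agree)
  clear hk'
  suffices Via D d i j k' ∧ detour t u d i j k = detour t u d i j k' from this.2
  induction h with
  | refl => exact ⟨hk, rfl⟩
  | tail _ h ih =>
    have hv : Via D d i j _ := ⟨h.1, ih.1.agree.trans h.2.1, h.2.2.1⟩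
    exact ⟨hv, ih.2.trans (E.detour_eq_of_compat hD H hi hj hij ih.1 hv h.2.2.2)⟩

omit hD in
lemma exists_via (hcard : Fintype.card α + 2 ≤ Fintype.card Ω) (D : Finset α) (d : α)
    (hi : Function.Injective i) (j l : α → Ω) : ∃ k, Via D d i j k ∧ Via D d i l k := by
  obtain ⟨k, h1, h2, h3, h4⟩ := exists_avoiding_pair hcard D hi (j d) (l d)
  exact ⟨k, ⟨h1, h2, h3⟩, ⟨h1, h2, h4⟩⟩

lemma Extension.insert (hcard : Fintype.card α + 2 ≤ Fintype.card Ω) (hd : d ∉ D)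
    (H : LocalSystem c D₀ t P) (E : Extension c D₀ D t P u) :
    ∃ w, Extension c D₀ (insert d D) t P w := by
  classical
  have hex : ∀ i j : α → Ω, ∃ k, Function.Injective i → Via D d i j k := by
    intro i j
    by_cases hi : Function.Injective i
    · obtain ⟨k, hk, -⟩ := exists_via hcard D d hi j j
      exact ⟨k, fun _ => hk⟩
    · exact ⟨i, fun h => absurd h hi⟩
  choose κ hκ using hex
  refine ⟨fun i j => detour t u d i j (κ i j), ?_, ?_, ?_⟩
  · intro i j hi hj hij hc
    have hv : Via D d i j i := by
      refine ⟨hi.1, fun _ _ => rfl, fun a ha h => ?_⟩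
      rw [hc _ _ h] at ha
      exact hd ha
    rw [E.detour_eq hD hcard H hi hj hij (hκ i j hi.1) hv]
    have hn := hv.ne hj.1 hij
    have h2 := hv.cfg_update hD hj hij
    have c1 := compat_update hi.compat_self hn
    have c2 : Compat (Function.update i d (j d)) j := by
      have := compat_update (a := d) hc.symm (p := j d) fun x hx => hj.1.ne hx
      exact this.symm
    unfold detour
    rw [E.eq hi hi (fun _ _ => rfl) hi.compat_self, E.eq h2 hj (hv.agree_update hij) c2,
      H.comp hi hi h2 hi.compat_self c1 c1, H.comp hi h2 hj c1 c2 hc]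
  · intro i j l hi hj hl hij hjl
    have hil := hij.trans hjl
    obtain ⟨k, hk, hk'⟩ := exists_via hcard D d hi.1 j l
    have hn := hk.ne hj.1 hij
    have hn' := hk'.ne hl.1 hil
    have hup := hk.agree_update hij
    have h1 := hk.cfg hD hi
    have h2 := hk.cfg_update hD hj hij
    have h3 := hk'.cfg_update hD hl hil
    have hv : Via D d j l (Function.update k d (j d)) := by
      refine ⟨h2.1, hup.symm, fun a ha => ?_⟩
      rw [Function.update_of_ne]
      · exact hk'.avoid a ha
      · rintro rfl; exact hd ha
    rw [E.detour_eq hD hcard H hi hj hij (hκ i j hi.1) hk,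
      E.detour_eq hD hcard H hj hl hjl (hκ j l hj.1) hv,
      E.detour_eq hD hcard H hi hl hil (hκ i l hi.1) hk']
    unfold detour
    have c1 := compat_update h1.compat_self hn
    have c2 := compat_update h1.compat_self hn'
    have c3 := compat_update_update h1.compat_self hn hn'
    rw [Function.update_idem, mul_assoc, mul_assoc, ← mul_assoc (u j _), E.comp h2 hj h2 hup hup.symm,
      E.eq h2 h2 (fun _ _ => rfl) h2.compat_self, ← mul_assoc (t _ _) (t _ _) (u i k),
      H.comp h1 h2 h2 c1 h2.compat_self c1, ← mul_assoc (t _ _) (t _ _) (u i k),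
      H.comp h1 h2 h3 c1 c3 c2]
  · intro i j hi hj hij
    have hk := hκ i j hi.1
    have h1 := hk.cfg hD hi
    have h2 := hk.cfg_update hD hj hij
    exact H.prop_mul hi h2 hj (H.prop_mul hi h1 h2 (E.prop hi h1 hk.agree)
      (H.prop h1 h2 (compat_update h1.compat_self (hk.ne hj.1 hij))))
      (E.prop h2 hj (hk.agree_update hij))

omit hD in
lemma LocalSystem.exists_extension (hcard : Fintype.card α + 2 ≤ Fintype.card Ω)
    (H : LocalSystem c D₀ t P) : ∃ u, Extension c D₀ D₀ t P u := by
  suffices ∀ D ⊆ D₀, ∃ u, Extension c D₀ D t P u from this _ subset_rfl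
  intro D
  induction D using Finset.induction_on with
  | empty =>
    intro _
    have h0 : ∀ {i j : α → Ω}, Agree ∅ i j → i = j := fun h => funext fun a => h a (by simp)
    refine ⟨t, fun _ _ _ _ => rfl, ?_, ?_⟩
    · intro i j k hi hj hk hij hjk
      obtain rfl := h0 hij
      obtain rfl := h0 hjk
      exact H.comp hi hi hi hi.compat_self hi.compat_self hi.compat_self
    · intro i j hi hj hij
      obtain rfl := h0 hij
      exact H.prop hi hi hi.compat_self
  | insert d D hd ih =>
    intro hD
    obtain ⟨u, hu⟩ := ih ((Finset.subset_insert d D).trans hD)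
    exact hu.insert hD hcard hd H

end Extend

end Cocycle

section Model

variable {Ω M : Type*} [Semigroup M]

/-- Idempotent self-maps of `Ω` fixing `K` pointwise. -/
def Good (K : Set Ω) (f : Ω → Ω) : Prop := (∀ x ∈ K, f x = x) ∧ ∀ x, f (f x) = f x

/-- A semigroup acting on `Ω`, generated by elements `G e` that act as the idempotents `e` and
multiply in the same way as these on basic pairs. -/
structure IdemModel (K : Set Ω) (φ : M → Ω → Ω) (G : (Ω → Ω) → M) : Prop where
  map_mul : ∀ x y, φ (x * y) = φ x ∘ φ y
  map_fix : ∀ m, ∀ x ∈ K, φ m x = x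
  map_gen : ∀ {f}, Good K f → φ (G f) = f
  gen_mul : ∀ {f g}, Good K f → Good K g → (f ∘ g = f ∨ f ∘ g = g ∨ g ∘ f = f ∨ g ∘ f = g) →
    G f * G g = G (f ∘ g)
  induction : ∀ (p : M → Prop) (_gen : ∀ f, Good K f → p (G f))
    (_mul : ∀ x y, p x → p y → p (x * y)) (x : M), p x

/-- `c` is injective, and `K` is the image under `c` of the complement of `D₀`. -/
structure Frame {α : Type*} (K : Set Ω) (c : α → Ω) (D₀ : Finset α) : Prop where
  inj : Function.Injective c
  mem : ∀ a ∉ D₀, c a ∈ K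
  exists_eq : ∀ x ∈ K, ∃ a ∉ D₀, c a = x

variable {α : Type*} {K : Set Ω} {φ : M → Ω → Ω} {G : (Ω → Ω) → M} {c : α → Ω} {D₀ : Finset α}
  {i j k : α → Ω} {s s' : Ω → α} {e : Ω → Ω}

open Function (LeftInverse)

lemma exists_leftInverse [Nonempty α] (S : Set (α → Ω)) (hS : ∀ i ∈ S, ∀ j ∈ S, Compat i j) :
    ∃ s : Ω → α, ∀ i ∈ S, LeftInverse s i := by
  classical
  refine ⟨fun x => if h : ∃ a, ∃ i ∈ S, i a = x then h.choose else Classical.arbitrary α,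
    fun i hi a => ?_⟩
  have h : ∃ b, ∃ j ∈ S, j b = i a := ⟨a, i, hi, rfl⟩
  change dite _ _ _ = a
  rw [dif_pos h]
  obtain ⟨j, hj, hja⟩ := h.choose_spec
  exact hS j hj i hi _ _ hja

lemma compat_of_leftInverse (hi : LeftInverse s i) (hj : LeftInverse s j) : Compat i j :=
  fun a b hab => by rw [← hi a, hab, hj b]

lemma Frame.cfg (F : Frame K c D₀) : Cfg c D₀ c := ⟨F.inj, fun _ _ => rfl⟩

lemma Frame.apply_mem (F : Frame K c D₀) (hi : Cfg c D₀ i) {x : Ω} (hx : x ∈ K) :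
    ∃ a, i a = x := by
  obtain ⟨a, ha, rfl⟩ := F.exists_eq x hx
  exact ⟨a, hi.2 a ha⟩

lemma Frame.good_comp (F : Frame K c D₀) (hi : Cfg c D₀ i) (hs : LeftInverse s i) :
    Good K (i ∘ s) := by
  refine ⟨fun x hx => ?_, fun x => congrArg i (hs (s x))⟩
  obtain ⟨a, rfl⟩ := F.apply_mem hi hx
  exact congrArg i (hs a)

lemma Frame.cfg_comp (F : Frame K c D₀) (hi : Cfg c D₀ i) {f : Ω → Ω} (hf : ∀ x ∈ K, f x = x)
    (hinj : Function.Injective (f ∘ i)) : Cfg c D₀ (f ∘ i) := by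
  refine ⟨hinj, fun a ha => ?_⟩
  rw [Function.comp_apply, hi.2 a ha, hf _ (F.mem a ha)]

namespace IdemModel

variable (H : IdemModel K φ G) (F : Frame K c D₀)
include H F

lemma gen_mul_left (hi : Cfg c D₀ i) (hs : LeftInverse s i) (hs' : LeftInverse s' i) :
    G (i ∘ s) * G (i ∘ s') = G (i ∘ s') := by
  have h : (i ∘ s) ∘ (i ∘ s') = i ∘ s' := funext fun x => congrArg i (hs (s' x))
  rw [H.gen_mul (F.good_comp hi hs) (F.good_comp hi hs') (Or.inr (Or.inl h)), h]

lemma gen_mul_right (hi : Cfg c D₀ i) (hj : Cfg c D₀ j) (hs : LeftInverse s i)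
    (hs' : LeftInverse s j) : G (i ∘ s) * G (j ∘ s) = G (i ∘ s) := by
  have h : (i ∘ s) ∘ (j ∘ s) = i ∘ s := funext fun x => congrArg i (hs' (s x))
  rw [H.gen_mul (F.good_comp hi hs) (F.good_comp hj hs') (Or.inl h), h]

lemma gen_mul_square (hi : Cfg c D₀ i) (hj : Cfg c D₀ j) (hsi : LeftInverse s i)
    (hsj : LeftInverse s j) (hsi' : LeftInverse s' i) (hsj' : LeftInverse s' j) :
    G (i ∘ s) * G (j ∘ s') = G (i ∘ s') := by
  classical
  let e : Ω → Ω := fun x => if x ∈ Set.range i ∪ Set.range j then x else i (s' x)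
  have hei : ∀ a, e (i a) = i a := fun a => if_pos (Or.inl ⟨a, rfl⟩)
  have hej : ∀ a, e (j a) = j a := fun a => if_pos (Or.inr ⟨a, rfl⟩)
  have he : Good K e := by
    constructor
    · intro x hx
      obtain ⟨a, rfl⟩ := F.apply_mem hi hx
      exact hei a
    · intro x
      by_cases hx : x ∈ Set.range i ∪ Set.range j
      · rw [show e x = x from if_pos hx, show e x = x from if_pos hx]
      · rw [show e x = i (s' x) from if_neg hx, hei]
  have hgi := F.good_comp hi hsi
  have hgj := F.good_comp hj hsj'
  have h1 : e ∘ (j ∘ s') = j ∘ s' := funext fun x => hej _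
  have h2 : e ∘ (i ∘ s) = i ∘ s := funext fun x => hei _
  have h3 : (i ∘ s) ∘ e = i ∘ s' := by
    funext x
    change i (s (e x)) = i (s' x)
    by_cases hx : x ∈ Set.range i ∪ Set.range j
    · rw [show e x = x from if_pos hx]
      rcases hx with ⟨a, rfl⟩ | ⟨a, rfl⟩
      · rw [hsi, hsi']
      · rw [hsj, hsj']
    · rw [show e x = i (s' x) from if_neg hx, hsi]
  calc G (i ∘ s) * G (j ∘ s') = G (i ∘ s) * (G e * G (j ∘ s')) := by
        rw [H.gen_mul he hgj (Or.inr (Or.inl h1)), h1]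
    _ = G (i ∘ s') * G (j ∘ s') := by
        rw [← mul_assoc, H.gen_mul hgi he (Or.inr (Or.inr (Or.inl h2))), h3]
    _ = G (i ∘ s') := H.gen_mul_right F hi hj hsi' hsj'

/-- The arrows between compatible configurations given by products of two idempotents. -/
lemma exists_localSystem [Nonempty α] : ∃ (σ : (α → Ω) → Ω → α) (t : (α → Ω) → (α → Ω) → M),
    (∀ i, Cfg c D₀ i → LeftInverse (σ i) i) ∧
    (∀ i j s, Cfg c D₀ i → Cfg c D₀ j → LeftInverse s i → LeftInverse s j →
      t i j = G (j ∘ s) * G (i ∘ σ i)) ∧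
    LocalSystem c D₀ t fun i j m => φ m = j ∘ σ i := by
  have hex : ∀ i j : α → Ω, ∃ s : Ω → α, Cfg c D₀ i → Cfg c D₀ j → Compat i j →
      LeftInverse s i ∧ LeftInverse s j := by
    intro i j
    by_cases h : Cfg c D₀ i ∧ Cfg c D₀ j ∧ Compat i j
    · obtain ⟨hi, hj, hc⟩ := h
      obtain ⟨s, hs⟩ := exists_leftInverse {i, j} (by
        rintro _ (rfl | rfl) _ (rfl | rfl)
        exacts [hi.compat_self, hc, hc.symm, hj.compat_self])
      exact ⟨s, fun _ _ _ => ⟨hs i (by simp), hs j (by simp)⟩⟩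
    · exact ⟨fun _ => Classical.arbitrary α, fun h1 h2 h3 => absurd ⟨h1, h2, h3⟩ h⟩
  choose τ hτ using hex
  have hσ : ∀ i, Cfg c D₀ i → LeftInverse (τ i i) i := fun i hi => (hτ i i hi hi hi.compat_self).1
  have ht : ∀ i j s, Cfg c D₀ i → Cfg c D₀ j → LeftInverse s i → LeftInverse s j →
      G (j ∘ τ i j) * G (i ∘ τ i i) = G (j ∘ s) * G (i ∘ τ i i) := by
    intro i j s hi hj hsi hsj
    obtain ⟨h1, h2⟩ := hτ i j hi hj (compat_of_leftInverse hsi hsj)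
    rw [← H.gen_mul_square F hj hi h2 h1 hsj hsi, mul_assoc, H.gen_mul_left F hi hsi (hσ i hi)]
  refine ⟨fun i => τ i i, fun i j => G (j ∘ τ i j) * G (i ∘ τ i i), hσ, ht, ?_, ?_, ?_⟩
  · intro i j k hi hj hk hij hjk hik
    obtain ⟨s, hs⟩ := exists_leftInverse {i, j, k} (by
        rintro _ (rfl | rfl | rfl) _ (rfl | rfl | rfl)
        exacts [hi.compat_self, hij, hik, hij.symm, hj.compat_self, hjk, hik.symm, hjk.symm,
          hk.compat_self])
    have hsi := hs i (by simp)
    have hsj := hs j (by simp)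
    have hsk := hs k (by simp)
    change G (k ∘ τ j k) * G (j ∘ τ j j) * (G (j ∘ τ i j) * G (i ∘ τ i i)) =
      G (k ∘ τ i k) * G (i ∘ τ i i)
    rw [ht j k s hj hk hsj hsk, ht i j s hi hj hsi hsj, ht i k s hi hk hsi hsk, mul_assoc,
      ← mul_assoc (G (j ∘ τ j j)), H.gen_mul_left F hj (hσ j hj) hsj, ← mul_assoc,
      H.gen_mul_right F hk hj hsk hsj]
  · intro i j hi hj hc
    obtain ⟨h1, h2⟩ := hτ i j hi hj hc
    rw [H.map_mul, H.map_gen (F.good_comp hj h2), H.map_gen (F.good_comp hi (hσ i hi))]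
    exact funext fun x => congrArg j (h1 _)
  · intro i j k m m' _ hj _ hm hm'
    rw [H.map_mul, hm, hm']
    exact funext fun x => congrArg k (hσ j hj _)

end IdemModel

/-- A functorial system of arrows `u i j` between configurations, together with its compatibility
with the generators of the semigroup. -/
structure Transport (K : Set Ω) (φ : M → Ω → Ω) (G : (Ω → Ω) → M) (c : α → Ω) (D₀ : Finset α)
    (u : (α → Ω) → (α → Ω) → M) : Prop where
  map_mul_gen : ∀ {i j s}, Cfg c D₀ i → Cfg c D₀ j → LeftInverse s j →
    φ (u j i * G (j ∘ s)) = i ∘ s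
  self_mul_gen : ∀ {i s}, Cfg c D₀ i → LeftInverse s i → u i i * G (i ∘ s) = G (i ∘ s)
  indep : ∀ {i j j' s}, Cfg c D₀ i → Cfg c D₀ j → Cfg c D₀ j' → LeftInverse s j →
    LeftInverse s j' → u j i * G (j ∘ s) = u j' i * G (j' ∘ s)
  gen_mul : ∀ {i j e}, Cfg c D₀ i → Cfg c D₀ j → Good K e → Cfg c D₀ (e ∘ i) →
    G e * u j i = u j (e ∘ i)

lemma IdemModel.exists_transport [Fintype α] [Fintype Ω] [Nonempty α] (H : IdemModel K φ G)
    (F : Frame K c D₀) (hcard : Fintype.card α + 2 ≤ Fintype.card Ω) :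
    ∃ u, Transport K φ G c D₀ u := by
  classical
  obtain ⟨σ, t, hσ, ht, hL⟩ := H.exists_localSystem F
  obtain ⟨u, E⟩ := hL.exists_extension hcard
  have hag : ∀ {i j}, Cfg c D₀ i → Cfg c D₀ j → Agree D₀ i j :=
    fun hi hj a ha => (hi.2 a ha).trans (hj.2 a ha).symm
  have hu : ∀ {i j s}, Cfg c D₀ i → Cfg c D₀ j → LeftInverse s i → LeftInverse s j →
      u i j = G (j ∘ s) * G (i ∘ σ i) := fun hi hj hsi hsj =>
    (E.eq hi hj (hag hi hj) (compat_of_leftInverse hsi hsj)).trans (ht _ _ _ hi hj hsi hsj)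
  have hself : ∀ {i}, Cfg c D₀ i → u i i = G (i ∘ σ i) := by
    intro i hi
    rw [hu hi hi (hσ i hi) (hσ i hi), H.gen_mul_left F hi (hσ i hi) (hσ i hi)]
  refine ⟨u, ?_, ?_, ?_, ?_⟩
  · intro i j s hi hj hs
    rw [H.map_mul, E.prop hj hi (hag hj hi), H.map_gen (F.good_comp hj hs)]
    exact funext fun x => congrArg i (hσ j hj _)
  · intro i s hi hs
    rw [hself hi, H.gen_mul_left F hi (hσ i hi) hs]
  · intro i j j' s hi hj hj' hs hs'
    rw [← E.comp hj hj' hi (hag hj hj') (hag hj' hi), hu hj hj' hs hs', mul_assoc, mul_assoc,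
      H.gen_mul_left F hj (hσ j hj) hs, H.gen_mul_right F hj' hj hs' hs]
  · intro i j e hi hj he hei
    have hs' := hσ _ hei
    have h1 : LeftInverse (σ (e ∘ i) ∘ e) i := hs'
    have h2 : LeftInverse (σ (e ∘ i) ∘ e) (e ∘ i) := fun a => by
      change σ (e ∘ i) (e (e (i a))) = a
      rw [he.2]
      exact hs' a
    have h3 : (i ∘ (σ (e ∘ i) ∘ e)) ∘ e = i ∘ (σ (e ∘ i) ∘ e) :=
      funext fun x => congrArg (fun y => i (σ (e ∘ i) y)) (he.2 x)
    have h4 : G e * G (i ∘ (σ (e ∘ i) ∘ e)) = G ((e ∘ i) ∘ (σ (e ∘ i) ∘ e)) :=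
      H.gen_mul he (F.good_comp hi h1) (Or.inr (Or.inr (Or.inr h3)))
    rw [← E.comp hj hi hei (hag hj hi) (hag hi hei), hu hi hei h1 h2, ← h4, mul_assoc (G e),
      H.gen_mul_left F hi h1 (hσ i hi), ← hself hi, mul_assoc, E.comp hj hi hi (hag hj hi)
      (hag hi hi)]

namespace Transport

variable {u : (α → Ω) → (α → Ω) → M}

lemma mul_eq (T : Transport K φ G c D₀ u) (H : IdemModel K φ G) (F : Frame K c D₀) (x : M)
    (hi : Cfg c D₀ i) (hj : Cfg c D₀ j) (hx : Function.Injective (φ x ∘ i)) :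
    x * u j i = u j (φ x ∘ i) := by
  induction x using H.induction generalizing i with
  | _gen f hf =>
    rw [H.map_gen hf] at hx ⊢
    exact T.gen_mul hi hj hf (F.cfg_comp hi hf.1 hx)
  | _mul x y ihx ihy =>
    rw [H.map_mul] at hx ⊢
    have hy : Function.Injective (φ y ∘ i) := Function.Injective.of_comp (f := φ x) hx
    rw [mul_assoc, ihy hi hy, ihx (F.cfg_comp hi (H.map_fix y) hy) hx]
    rfl

lemma mul_gen_mul_eq (T : Transport K φ G c D₀ u) (H : IdemModel K φ G) (F : Frame K c D₀) (x : M)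
    (hi : Cfg c D₀ i) (hj : Cfg c D₀ j) (hs : LeftInverse s j) (hk : Cfg c D₀ k)
    (hsk : LeftInverse (s ∘ φ x) k) :
    u j i * G (j ∘ s) * x = u k i * G (k ∘ (s ∘ φ x)) := by
  induction x using H.induction generalizing j s k with
  | _gen e he =>
    rw [H.map_gen he] at hsk ⊢
    have h1 : LeftInverse s (e ∘ k) := hsk
    have h0 : Cfg c D₀ (e ∘ k) := F.cfg_comp hk he.1 h1.injective
    have h2 : LeftInverse (s ∘ e) (e ∘ k) := fun a => by
      change s (e (e (k a))) = a
      rw [he.2]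
      exact hsk a
    have h3 : e ∘ ((e ∘ k) ∘ s) = (e ∘ k) ∘ s := funext fun x => he.2 _
    rw [T.indep hi hj h0 hs h1, mul_assoc,
      H.gen_mul (F.good_comp h0 h1) he (Or.inr (Or.inr (Or.inl h3)))]
    exact T.indep hi h0 hk h2 hsk
  | _mul x y ihx ihy =>
    rw [H.map_mul] at hsk ⊢
    have h1 : LeftInverse (s ∘ φ x) (φ y ∘ k) := hsk
    have h0 : Cfg c D₀ (φ y ∘ k) := F.cfg_comp hk (H.map_fix y) h1.injective
    rw [← mul_assoc, ihx hj hs h0 h1]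
    exact ihy h0 h1 hk hsk

end Transport

/-- The 𝓙-class of `G e` is finite if the rank of `e` is at most `|Ω| - 2`. -/
lemma IdemModel.exists_finite_class [Fintype Ω] (H : IdemModel K φ G) (he : Good K e)
    (hcard : (Set.range e).ncard + 2 ≤ Fintype.card Ω) :
    ∃ B : Set M, B.Finite ∧ G e ∈ B ∧ (∀ a ∈ B, ∀ g h, a * g * h = a → a * g ∈ B) ∧
      (∀ a ∈ B, ∀ g h, h * (g * a) = a → g * a ∈ B) ∧
      ∀ a ∈ B, (Set.range (φ a)).ncard + 2 ≤ Fintype.card Ω := by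
  classical
  have hΩ : Nonempty Ω := Fintype.card_pos_iff.1 (by omega)
  let c : Set.range e → Ω := Subtype.val
  let D₀ : Finset (Set.range e) := Finset.univ.filter fun a => (a : Ω) ∉ K
  have F : Frame K c D₀ := by
    refine ⟨Subtype.val_injective, fun a ha => ?_, fun x hx => ?_⟩
    · simpa [D₀] using ha
    · exact ⟨⟨x, x, he.1 x hx⟩, by simpa [D₀] using hx, rfl⟩
  have hα : Fintype.card (Set.range e) + 2 ≤ Fintype.card Ω := by
    rwa [← Nat.card_eq_fintype_card, Nat.card_coe_set_eq]
  have : Nonempty (Set.range e) := ⟨⟨_, Classical.arbitrary Ω, rfl⟩⟩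
  obtain ⟨u, T⟩ := H.exists_transport F hα
  refine ⟨{m | ∃ i j s, Cfg c D₀ i ∧ Cfg c D₀ j ∧ LeftInverse s j ∧ m = u j i * G (j ∘ s)},
    ?_, ?_, ?_, ?_, ?_⟩
  · refine (Set.finite_range fun p : (Set.range e → Ω) × (Set.range e → Ω) × (Ω → Set.range e) =>
      u p.2.1 p.1 * G (p.2.1 ∘ p.2.2)).subset ?_
    rintro _ ⟨i, j, s, -, -, -, rfl⟩
    exact ⟨(i, j, s), rfl⟩
  · have hs : LeftInverse (Set.rangeFactorization e) c := by
      rintro ⟨_, x, rfl⟩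
      exact Subtype.ext (he.2 x)
    exact ⟨c, c, Set.rangeFactorization e, F.cfg, F.cfg, hs, (T.self_mul_gen F.cfg hs).symm⟩
  · rintro _ ⟨i, j, s, hi, hj, hs, rfl⟩ g h hgh
    have h1 : ∀ x, s (φ g (φ h x)) = s x := by
      have h2 := congrArg φ hgh
      rw [H.map_mul, H.map_mul, T.map_mul_gen hi hj hs] at h2
      exact fun x => hi.1 (congrFun h2 x)
    have h3 : LeftInverse (s ∘ φ g) (φ h ∘ j) := fun a => (h1 _).trans (hs a)
    have h0 : Cfg c D₀ (φ h ∘ j) := F.cfg_comp hj (H.map_fix h) h3.injective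
    exact ⟨i, _, _, hi, h0, h3, T.mul_gen_mul_eq H F g hi hj hs h0 h3⟩
  · rintro _ ⟨i, j, s, hi, hj, hs, rfl⟩ g h hgh
    have h1 : Function.Injective (φ g ∘ i) := by
      have h2 := congrArg φ hgh
      rw [H.map_mul, H.map_mul, T.map_mul_gen hi hj hs] at h2
      have h3 : ∀ a, φ h (φ g (i a)) = i a := fun a => by
        simpa only [Function.comp_apply, hs a] using congrFun h2 (j a)
      exact Function.Injective.of_comp (f := φ h) fun a b hab => hi.1 (by
        rw [← h3 a, ← h3 b]
        exact hab)
    refine ⟨φ g ∘ i, j, s, F.cfg_comp hi (H.map_fix g) h1, hj, hs, ?_⟩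
    rw [← mul_assoc, T.mul_eq H F g hi hj h1]
  · rintro _ ⟨i, j, s, hi, hj, hs, rfl⟩
    rw [T.map_mul_gen hi hj hs]
    refine le_trans ?_ hα
    have h1 : (Set.range (i ∘ s)).ncard ≤ (Set.range i).ncard :=
      Set.ncard_le_ncard (Set.range_comp_subset_range s i)
    have h2 : (Set.range i).ncard ≤ Fintype.card (Set.range e) := by
      rw [← Nat.card_eq_fintype_card, ← Set.ncard_univ, ← Set.image_univ]
      exact Set.ncard_image_le
    omega

end Model

section Reachability

variable {Y : Type*}

/-- The list of elements reachable from `a` in at most `k` steps, where `succs` lists the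
one-step successors of an element. -/
def reachList (succs : Y → List Y) (a : Y) : ℕ → List Y
  | 0 => [a]
  | k + 1 => reachList succs a k ++ (reachList succs a k).flatMap succs

variable {succs : Y → List Y} {a : Y}

lemma reachList_mono {j k : ℕ} (h : j ≤ k) : reachList succs a j ⊆ reachList succs a k := by
  induction h with
  | refl => exact List.Subset.refl _
  | step _ ih => exact List.Subset.trans ih (List.subset_append_left _ _)

lemma reflTransGen_of_mem_reachList {k : ℕ} {b : Y} (h : b ∈ reachList succs a k) :
    ReflTransGen (fun x y => y ∈ succs x) a b := by
  induction k generalizing b with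
  | zero => rw [reachList, List.mem_singleton] at h; subst h; exact .refl
  | succ k ih =>
    rw [reachList, List.mem_append, List.mem_flatMap] at h
    rcases h with h | ⟨c, hc, hb⟩
    · exact ih h
    · exact (ih hc).tail hb

lemma exists_reachList_closed (W : Finset Y) (hW : ∀ k, ∀ b ∈ reachList succs a k, b ∈ W) :
    ∃ j ≤ W.card, reachList succs a (j + 1) ⊆ reachList succs a j := by
  classical
  by_contra! hcon
  have key : ∀ k ≤ W.card + 1, k + 1 ≤ (reachList succs a k).toFinset.card := by
    intro k hk
    induction k with
    | zero => simp [reachList]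
    | succ k ih =>
      have h1 := ih (by omega)
      obtain ⟨b, hb, hb'⟩ : ∃ b ∈ reachList succs a (k + 1), b ∉ reachList succs a k := by
        have := hcon k (by omega)
        simpa [List.subset_def] using this
      have : (reachList succs a k).toFinset ⊂ (reachList succs a (k + 1)).toFinset := by
        refine (Finset.ssubset_iff_of_subset ?_).2 ⟨b, by simpa using hb, by simpa using hb'⟩
        intro x hx
        rw [List.mem_toFinset] at hx ⊢
        exact reachList_mono (Nat.le_succ k) hx
      have := Finset.card_lt_card this
      omega
  have h1 := key (W.card + 1) le_rfl
  have h2 : (reachList succs a (W.card + 1)).toFinset ⊆ W := by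
    intro x hx
    exact hW _ x (List.mem_toFinset.1 hx)
  have := Finset.card_le_card h2
  omega

lemma mem_reachList_iff (W : Finset Y) (hW : ∀ k, ∀ b ∈ reachList succs a k, b ∈ W)
    {N : ℕ} (hN : W.card ≤ N) {b : Y} :
    b ∈ reachList succs a N ↔ ReflTransGen (fun x y => y ∈ succs x) a b := by
  refine ⟨reflTransGen_of_mem_reachList, fun h => ?_⟩
  obtain ⟨j, hj, hcl⟩ := exists_reachList_closed W hW
  refine reachList_mono (hj.trans hN) ?_
  induction h with
  | refl => exact reachList_mono (Nat.zero_le j) (by simp [reachList])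
  | tail _ hbc ih =>
    refine hcl ?_
    rw [reachList, List.mem_append, List.mem_flatMap]
    exact Or.inr ⟨_, ih, hbc⟩

end Reachability

section WordSearch

variable {X : Type*}

/-- All one-step rewrites of a word, where `rl x y` lists the replacements of the factor `x y`. -/
def succs (rl : X → X → List (List X)) : List X → List (List X)
  | [] => []
  | x :: w => (w.head?.toList.flatMap fun y => (rl x y).map (· ++ w.tail)) ++
      (succs rl w).map (x :: ·)

/-- All words of length at most `n` over the letters in `l`. -/
def wordsUpTo (l : List X) : ℕ → List (List X)
  | 0 => [[]]
  | n + 1 => [] :: (wordsUpTo l n).flatMap fun w => l.map (· :: w)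

lemma mem_wordsUpTo {l : List X} (hl : ∀ x, x ∈ l) {n : ℕ} {w : List X} (h : w.length ≤ n) :
    w ∈ wordsUpTo l n := by
  induction n generalizing w with
  | zero => simp_all [wordsUpTo]
  | succ n ih =>
    cases w with
    | nil => simp [wordsUpTo]
    | cons x w =>
      simp only [wordsUpTo, List.mem_cons, List.mem_flatMap, List.mem_map]
      exact Or.inr ⟨w, ih (by simpa using h), x, hl x, rfl⟩

lemma length_le_of_mem_succs {rl : X → X → List (List X)}
    (hrl : ∀ x y, ∀ r ∈ rl x y, r.length ≤ 2) {w w' : List X} (h : w' ∈ succs rl w) :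
    w'.length ≤ w.length := by
  induction w generalizing w' with
  | nil => simp [succs] at h
  | cons x w ih =>
    simp only [succs, List.mem_append, List.mem_flatMap, List.mem_map] at h
    rcases h with ⟨y, hy, r, hr, rfl⟩ | ⟨v, hv, rfl⟩
    · cases w with
      | nil => simp at hy
      | cons z w =>
        obtain rfl : y = z := by simpa using hy
        have := hrl _ _ _ hr
        simp; omega
    · simpa using ih hv

lemma length_le_of_mem_reachList {rl : X → X → List (List X)}
    (hrl : ∀ x y, ∀ r ∈ rl x y, r.length ≤ 2) {w w' : List X} {k : ℕ}
    (h : w' ∈ reachList (succs rl) w k) : w'.length ≤ w.length := by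
  have hr := reflTransGen_of_mem_reachList h
  clear h
  induction hr with
  | refl => exact le_rfl
  | tail _ h ih => exact (length_le_of_mem_succs hrl h).trans ih

variable [Primcodable X]

lemma primrec_succs [Finite X] (rl : X → X → List (List X)) : Primrec (succs rl) := by
  have hrl : Primrec fun p : X × X => rl p.1 p.2 := Primrec.dom_finite _
  have hh : Primrec₂ fun (_ : List X) (p : X × List X × List (List X)) =>
      (p.2.1.head?.toList.flatMap fun y => (rl p.1 y).map (· ++ p.2.1.tail)) ++
        p.2.2.map (p.1 :: ·) := by
    have hp : Primrec fun q : List X × (X × List X × List (List X)) => q.2 := Primrec.snd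
    have hp1 := Primrec.fst.comp hp
    have hp21 := Primrec.fst.comp (Primrec.snd.comp hp)
    have hp22 := Primrec.snd.comp (Primrec.snd.comp hp)
    refine Primrec.list_append.comp ?_ ?_
    · refine Primrec.list_flatMap (Primrec.optionToList.comp (Primrec.list_head?.comp hp21)) ?_
      refine Primrec.list_map (hrl.comp (Primrec.pair (hp1.comp Primrec.fst) Primrec.snd)) ?_
      exact Primrec.list_append.comp Primrec.snd
        (Primrec.list_tail.comp (hp21.comp (Primrec.fst.comp Primrec.fst)))
    · exact Primrec.list_map hp22 (Primrec.list_cons.comp (hp1.comp Primrec.fst) Primrec.snd)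
  refine (Primrec.list_rec Primrec.id (Primrec.const []) hh).of_eq fun w => ?_
  induction w with
  | nil => rfl
  | cons x w ih =>
    simp only [id] at ih ⊢
    simp only [succs, ← ih]

lemma primrec_reachList {Y : Type*} [Primcodable Y] {s : Y → List Y} (hs : Primrec s) :
    Primrec₂ (reachList s) := by
  have hg : Primrec₂ fun (_ : Y) (p : ℕ × List Y) => p.2 ++ p.2.flatMap s := by
    have hp : Primrec fun q : Y × (ℕ × List Y) => q.2.2 := Primrec.snd.comp Primrec.snd
    exact Primrec.list_append.comp hp (Primrec.list_flatMap hp (hs.comp Primrec.snd))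
  have hf : Primrec fun a : Y => [a] :=
    Primrec.list_cons.comp Primrec.id (Primrec.const [])
  refine (Primrec.nat_rec hf hg).of_eq fun a n => ?_
  induction n with
  | zero => rfl
  | succ n ih => simp only [reachList, ← ih]

lemma primrec_wordsUpTo (l : List X) : Primrec (wordsUpTo l) := by
  have hg : Primrec₂ fun (_ : ℕ) (p : List (List X)) =>
      [] :: p.flatMap fun w => l.map (· :: w) := by
    refine Primrec.list_cons.comp (Primrec.const []) (Primrec.list_flatMap Primrec.snd ?_)
    exact Primrec.list_map (Primrec.const l)
      (Primrec.list_cons.comp Primrec.snd (Primrec.snd.comp Primrec.fst))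
  refine (Primrec.nat_rec₁ [[]] hg).of_eq fun n => ?_
  induction n with
  | zero => rfl
  | succ n ih => simp only [wordsUpTo, ← ih]

/-- For a length non-increasing rewriting relation over a finite alphabet, it is decidable
whether two words have a common descendant. -/
lemma primrecPred_joinable [Finite X] (rl : X → X → List (List X))
    (hrl : ∀ x y, ∀ r ∈ rl x y, r.length ≤ 2) :
    PrimrecPred fun p : List X × List X => ∃ w,
      ReflTransGen (fun u v => v ∈ succs rl u) p.1 w ∧
      ReflTransGen (fun u v => v ∈ succs rl u) p.2 w := by
  classical
  obtain ⟨l, hl⟩ : ∃ l : List X, ∀ x, x ∈ l := by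
    have := Fintype.ofFinite X
    exact ⟨Finset.univ.toList, by simp⟩
  let R : List X → List (List X) := fun w =>
    reachList (succs rl) w (wordsUpTo l w.length).length
  have hR : Primrec R := (primrec_reachList (primrec_succs rl)).comp Primrec.id
    (Primrec.list_length.comp ((primrec_wordsUpTo l).comp Primrec.list_length))
  have hmem : ∀ u w, w ∈ R u ↔ ReflTransGen (fun u v => v ∈ succs rl u) u w := by
    intro u w
    refine mem_reachList_iff (wordsUpTo l u.length).toFinset (fun k b hb => ?_)
      (List.toFinset_card_le _)
    rw [List.mem_toFinset]
    exact mem_wordsUpTo hl (length_le_of_mem_reachList hrl hb)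
  have heq : PrimrecRel fun a b : List X => a = b := Primrec.eq
  have h1 : PrimrecRel fun (L : List (List X)) (b : List X) => ∃ a ∈ L, a = b :=
    heq.exists_mem_list
  have h2 : PrimrecRel fun (b : List X) (L : List (List X)) => ∃ a ∈ L, a = b :=
    h1.comp Primrec.snd Primrec.fst
  have h3 := h2.exists_mem_list
  refine (h3.comp (hR.comp Primrec.fst) (hR.comp Primrec.snd)).of_eq fun p => ?_
  simp only [exists_eq_right, hmem]

end WordSearch

section Classes

variable {Ω M : Type*} [Semigroup M] {K : Set Ω} {φ : M → Ω → Ω} {G : (Ω → Ω) → M}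
  {e f : Ω → Ω}

lemma Good.comp_of_basic (he : Good K e) (hf : Good K f)
    (h : e ∘ f = e ∨ e ∘ f = f ∨ f ∘ e = e ∨ f ∘ e = f) : Good K (e ∘ f) := by
  refine ⟨fun x hx => by rw [Function.comp_apply, hf.1 x hx, he.1 x hx], fun x => ?_⟩
  rcases h with h | h | h | h
  · rw [h, he.2]
  · rw [h, hf.2]
  · change e (f (e (f x))) = e (f x)
    rw [show f (e (f x)) = e (f x) from congrFun h (f x), he.2]
  · change e (f (e (f x))) = e (f x)
    rw [show f (e (f x)) = f (f x) from congrFun h (f x), hf.2]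

variable [Fintype Ω]

lemma ncard_range_comp_le_left (e f : Ω → Ω) :
    (Set.range (e ∘ f)).ncard ≤ (Set.range e).ncard :=
  Set.ncard_le_ncard (Set.range_comp_subset_range f e)

lemma ncard_range_comp_le_right (e f : Ω → Ω) :
    (Set.range (e ∘ f)).ncard ≤ (Set.range f).ncard := by
  rw [Set.range_comp]
  exact Set.ncard_image_le

lemma eq_id_or_ncard_range_lt (he : ∀ x, e (e x) = e x) :
    e = id ∨ (Set.range e).ncard < Fintype.card Ω := by
  by_cases h : Function.Surjective e
  · left
    funext x
    obtain ⟨y, rfl⟩ := h x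
    exact he y
  · right
    rw [← Nat.card_eq_fintype_card, ← Set.ncard_univ]
    exact Set.ncard_lt_ncard (Set.ssubset_univ_iff.2 fun h' => h (Set.range_eq_univ.1 h'))

lemma comp_eq_right_of_range (he : Good K e) (hf : Good K f) (h : f ∘ e = e)
    (hcard : Fintype.card Ω ≤ (Set.range e).ncard + 1) : e ∘ f = e ∨ e ∘ f = f := by
  rcases eq_id_or_ncard_range_lt hf.2 with rfl | hlt
  · exact Or.inl rfl
  right
  have hsub : Set.range e ⊆ Set.range f := by
    rintro _ ⟨x, rfl⟩
    exact ⟨e x, congrFun h x⟩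
  have heq : Set.range e = Set.range f := Set.eq_of_subset_of_ncard_le hsub (by omega)
  funext x
  obtain ⟨y, hy⟩ : f x ∈ Set.range e := heq ▸ ⟨x, rfl⟩
  rw [Function.comp_apply, ← hy, he.2]

lemma comp_eq_left_of_ker (he : Good K e) (hf : Good K f) (h : f ∘ e = f)
    (hcard : Fintype.card Ω ≤ (Set.range f).ncard + 1) : e ∘ f = e ∨ e ∘ f = f := by
  rcases eq_id_or_ncard_range_lt he.2 with rfl | hlt
  · exact Or.inr rfl
  left
  have himg : f '' Set.range e = Set.range f := by rw [← Set.range_comp, h]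
  have hinj : Set.InjOn f (Set.range e) := by
    refine Set.injOn_of_ncard_image_eq (le_antisymm Set.ncard_image_le ?_)
    rw [himg]
    omega
  funext x
  refine hinj ⟨f x, rfl⟩ ⟨x, rfl⟩ ?_
  change (f ∘ e) (f x) = (f ∘ e) x
  rw [h, hf.2]

/-- The generators of rank at least `|Ω| - 1` together with the 𝓙-classes of the remaining ones
form a finite set of letters for which all basic relations are length-reducing rules. -/
lemma IdemModel.exists_greenClosed (H : IdemModel K φ G) : ∃ X B : Set M, X.Finite ∧
    GreenClosed X B ∧ (∀ e, Good K e → G e ∈ X) ∧ ∀ e f, Good K e → Good K f →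
      (e ∘ f = e ∨ e ∘ f = f ∨ f ∘ e = e ∨ f ∘ e = f) →
      RhoOn B (G e) (G (e ∘ f)) ∨ LamOn B (G f) (G (e ∘ f)) := by
  classical
  have hex : ∀ e, ∃ B : Set M, B.Finite ∧
      (Good K e → (Set.range e).ncard + 2 ≤ Fintype.card Ω → G e ∈ B) ∧
      (∀ a ∈ B, ∀ g h, a * g * h = a → a * g ∈ B) ∧
      (∀ a ∈ B, ∀ g h, h * (g * a) = a → g * a ∈ B) ∧
      ∀ a ∈ B, (Set.range (φ a)).ncard + 2 ≤ Fintype.card Ω := by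
    intro e
    by_cases h : Good K e ∧ (Set.range e).ncard + 2 ≤ Fintype.card Ω
    · obtain ⟨B, h1, h2, h3, h4, h5⟩ := H.exists_finite_class h.1 h.2
      exact ⟨B, h1, fun _ _ => h2, h3, h4, h5⟩
    · exact ⟨∅, Set.finite_empty, fun h1 h2 => absurd ⟨h1, h2⟩ h, by simp, by simp, by simp⟩
  choose C hfin hmem hright hleft hrank using hex
  let A : Set M := G '' {e | Good K e ∧ Fintype.card Ω ≤ (Set.range e).ncard + 1}
  let B : Set M := ⋃ e, C e
  have hB : ∀ e, Good K e → (Set.range e).ncard + 2 ≤ Fintype.card Ω → G e ∈ B :=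
    fun e he h => Set.mem_iUnion.2 ⟨e, hmem e he h⟩
  have hBrank : ∀ a ∈ B, (Set.range (φ a)).ncard + 2 ≤ Fintype.card Ω := by
    intro a ha
    obtain ⟨e, he⟩ := Set.mem_iUnion.1 ha
    exact hrank e a he
  have hmemB : ∀ a ∈ A ∪ B, (Set.range (φ a)).ncard + 2 ≤ Fintype.card Ω → a ∈ B := by
    rintro _ (⟨e, he, rfl⟩ | ha) h
    · rw [H.map_gen he.1] at h
      have := he.2
      omega
    · exact ha
  refine ⟨A ∪ B, B, ?_, ?_, ?_, ?_⟩
  · exact ((Set.toFinite _).image G).union (Set.finite_iUnion hfin)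
  · refine ⟨Set.subset_union_right, ?_, ?_, ?_, ?_⟩
    · intro a ha g h hgh
      obtain ⟨e, he⟩ := Set.mem_iUnion.1 ha
      exact Set.mem_iUnion.2 ⟨e, hright e a he g h hgh⟩
    · intro a ha g h hgh
      obtain ⟨e, he⟩ := Set.mem_iUnion.1 ha
      exact Set.mem_iUnion.2 ⟨e, hleft e a he g h hgh⟩
    · intro x _ y hy hxy
      refine hmemB _ hxy (le_trans (Nat.add_le_add_right ?_ 2) (hBrank y hy))
      rw [H.map_mul]
      exact ncard_range_comp_le_right _ _
    · intro x _ y hy hxy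
      refine hmemB _ hxy (le_trans (Nat.add_le_add_right ?_ 2) (hBrank y hy))
      rw [H.map_mul]
      exact ncard_range_comp_le_left _ _
  · intro e he
    by_cases h : (Set.range e).ncard + 2 ≤ Fintype.card Ω
    · exact Or.inr (hB e he h)
    · exact Or.inl ⟨e, ⟨he, by omega⟩, rfl⟩
  · intro e f he hf h
    have hef := he.comp_of_basic hf h
    have hmul := H.gen_mul he hf h
    have htriv : (e ∘ f = e ∨ e ∘ f = f) →
        RhoOn B (G e) (G (e ∘ f)) ∨ LamOn B (G f) (G (e ∘ f)) := by
      rintro (h | h)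
      · exact Or.inl (Or.inl (by rw [h]))
      · exact Or.inr (Or.inl (by rw [h]))
    rcases h with h | h | h | h
    · exact htriv (Or.inl h)
    · exact htriv (Or.inr h)
    · by_cases hlow : (Set.range e).ncard + 2 ≤ Fintype.card Ω
      · have h1 : (e ∘ f) ∘ e = e := by
          rw [Function.comp_assoc, h]
          exact funext he.2
        refine Or.inl (Or.inr ⟨hB e he hlow, hB _ hef ?_, G f, G e, hmul, ?_⟩)
        · have := ncard_range_comp_le_left e f
          omega
        · rw [H.gen_mul hef he (Or.inr (Or.inl h1)), h1]
      · exact htriv (comp_eq_right_of_range he hf h (by omega))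
    · by_cases hlow : (Set.range f).ncard + 2 ≤ Fintype.card Ω
      · have h1 : f ∘ (e ∘ f) = f := by
          rw [← Function.comp_assoc, h]
          exact funext hf.2
        refine Or.inr (Or.inr ⟨hB f hf hlow, hB _ hef ?_, G e, G f, hmul, ?_⟩)
        · have := ncard_range_comp_le_right e f
          omega
        · rw [H.gen_mul hf hef (Or.inl h1), h1]
      · exact htriv (comp_eq_left_of_ker he hf h (by omega))

end Classes

section WordProblem

variable {S : Type*} [Semigroup S]

lemma igBar_mul (u v : FreeSemigroup (IdemE S)) : igBar (u * v) = igBar u * igBar v := rfl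

lemma igBar_eq_iff {u v : FreeSemigroup (IdemE S)} : igBar u = igBar v ↔ igCon S u v :=
  Con.eq _

lemma igBar_of_mul_of {e f g : IdemE S} (h : BasicPair e f) (hg : (g : S) = e * f) :
    igBar (FreeSemigroup.of e) * igBar (FreeSemigroup.of f) = igBar (FreeSemigroup.of g) :=
  igBar_eq_iff.2 (ConGen.Rel.of _ _ ⟨e, f, g, h, hg, rfl, rfl⟩)

/-- The free idempotent generated semigroup of the semigroup of all self-maps of `Ω` fixing `K`
pointwise is an `IdemModel`. -/
lemma exists_idemModel {Ω : Type*} (K : Set Ω) (ψ : S → Ω → Ω) (hinj : Function.Injective ψ)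
    (hmul : ∀ a b, ψ (a * b) = ψ a ∘ ψ b) (hran : ∀ f, (∃ a, ψ a = f) ↔ ∀ x ∈ K, f x = x) :
    ∃ (φ : IG S → Ω → Ω) (G : (Ω → Ω) → IG S), IdemModel K φ G ∧
      ∀ e : IdemE S, G (ψ e) = igBar (FreeSemigroup.of e) := by
  let ψ' : FreeSemigroup (IdemE S) →ₙ* Function.End Ω :=
    FreeSemigroup.lift fun e => (ψ e : Function.End Ω)
  have hker : igCon S ≤ Con.ker ψ' := by
    refine Con.conGen_le.2 ?_
    rintro _ _ ⟨e, f, g, -, hg, rfl, rfl⟩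
    change ψ e ∘ ψ f = ψ g
    rw [hg, hmul]
  let φ : IG S → Ω → Ω := fun m => Con.liftOn m ψ' fun _ _ h => hker h
  have hgood : ∀ e : IdemE S, Good K (ψ e) := by
    intro e
    refine ⟨(hran _).1 ⟨e, rfl⟩, fun x => ?_⟩
    have := hmul e e
    rw [e.2] at this
    exact (congrFun this x).symm
  have hlift : ∀ f, Good K f → ∃ e : IdemE S, ψ e = f := by
    intro f hf
    obtain ⟨a, ha⟩ := (hran f).2 hf.1
    refine ⟨⟨a, hinj ?_⟩, ha⟩
    rw [hmul, ha]
    exact funext hf.2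
  obtain ⟨e₁, -⟩ := hlift id ⟨fun _ _ => rfl, fun _ => rfl⟩
  have hex : ∀ f, ∃ m : IG S, ∀ e : IdemE S, ψ e = f → m = igBar (FreeSemigroup.of e) := by
    intro f
    by_cases h : ∃ e : IdemE S, ψ e = f
    · obtain ⟨e, he⟩ := h
      refine ⟨igBar (FreeSemigroup.of e), fun e' he' => ?_⟩
      rw [Subtype.ext (hinj (he.trans he'.symm))]
    · exact ⟨igBar (FreeSemigroup.of e₁), fun e he => absurd ⟨e, he⟩ h⟩
  choose G hG using hex
  refine ⟨φ, G, ⟨?_, ?_, ?_, ?_, ?_⟩, fun e => hG _ e rfl⟩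
  · intro x y
    induction x, y using Con.induction_on₂ with
    | H u v => exact map_mul ψ' u v
  · intro m x hx
    induction m using Con.induction_on with
    | H u =>
      change ψ' u x = x
      induction u using FreeSemigroup.recOnMul with
      | ih1 e => exact (hgood e).1 x hx
      | ih2 e v ih1 ih2 =>
        rw [map_mul]
        change ψ' _ (ψ' v x) = x
        rw [ih2, ih1]
  · intro f hf
    obtain ⟨e, rfl⟩ := hlift f hf
    rw [hG _ e rfl]
    rfl
  · intro f g hf hg h
    obtain ⟨e, rfl⟩ := hlift f hf
    obtain ⟨e', rfl⟩ := hlift g hg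
    obtain ⟨d, hd⟩ := hlift _ (hf.comp_of_basic hg h)
    rw [hG _ e rfl, hG _ e' rfl, hG _ d hd]
    refine igBar_of_mul_of ?_ (hinj (hd.trans (hmul _ _).symm))
    simpa only [BasicPair, ← hmul, hinj.eq_iff] using h
  · intro p h1 h2 x
    induction x using Con.induction_on with
    | H u =>
      induction u using FreeSemigroup.recOnMul with
      | ih1 e =>
        have h := h1 _ (hgood e)
        rwa [hG _ e rfl] at h
      | ih2 e v ih1 ih2 => exact h2 _ _ ih1 ih2

/-- The product of a word, in the semigroup with an identity adjoined. -/
def wordProd {M : Type*} [Semigroup M] {X : Set M} (w : List X) : WithOne M :=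
  (w.map fun x : X => ((x : M) : WithOne M)).prod

lemma wordProd_eq_of_step {M : Type*} [Semigroup M] {X B : Set M} {u v : List X}
    (h : Step (RedRule X B) (MoveRule X B) u v) : wordProd u = wordProd v := by
  have hcons : ∀ (x : X) (w : List X), wordProd (x :: w) = ((x : M) : WithOne M) * wordProd w :=
    fun _ _ => rfl
  have htr : ∀ {x y x' y' : X}, Transfer X B x y x' y' → (x : M) * y = x' * y' := by
    rintro x y x' y' ⟨m, h1, h2, -, -⟩
    rw [h1, h2, mul_assoc]
  rcases h with h | h
  · induction h with
    | head h => simp only [hcons, ← mul_assoc, ← WithOne.coe_mul, h.1]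
    | tail _ ih => rw [hcons, hcons, ih]
  · induction h with
    | head h =>
      rcases h with h | h
      · simp only [hcons, ← mul_assoc, ← WithOne.coe_mul, htr h]
      · simp only [hcons, ← mul_assoc, ← WithOne.coe_mul, htr h]
    | tail _ ih => rw [hcons, hcons, ih]

lemma wordProd_eq_of_steps {M : Type*} [Semigroup M] {X B : Set M} {u v : List X}
    (h : ReflTransGen (Step (RedRule X B) (MoveRule X B)) u v) : wordProd u = wordProd v := by
  induction h with
  | refl => rfl
  | tail _ h ih => exact ih.trans (wordProd_eq_of_step h)

lemma wordList_mul (u v : FreeSemigroup (IdemE S)) :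
    wordList (u * v) = wordList u ++ wordList v := rfl

lemma igBar_eq_iff_joinable {X B : Set (IG S)} (HB : GreenClosed X B) (ℓ : IdemE S → X)
    (hℓ : ∀ e, (ℓ e : IG S) = igBar (FreeSemigroup.of e))
    (hbasic : ∀ e f g : IdemE S, BasicPair e f → (g : S) = e * f →
      RhoOn B (ℓ e : IG S) (ℓ g) ∨ LamOn B (ℓ f : IG S) (ℓ g)) (u v : FreeSemigroup (IdemE S)) :
    igBar u = igBar v ↔
      Joinable (RedRule X B) (MoveRule X B) ((wordList u).map ℓ) ((wordList v).map ℓ) := by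
  constructor
  · intro h
    have happ : ∀ {a b : List X} (f : List X → List X),
        (∀ {a b}, Step (RedRule X B) (MoveRule X B) a b →
          Step (RedRule X B) (MoveRule X B) (f a) (f b)) →
        EqvGen (Step (RedRule X B) (MoveRule X B)) a b →
        EqvGen (Step (RedRule X B) (MoveRule X B)) (f a) (f b) := by
      intro a b f hf h
      induction h with
      | rel _ _ h => exact .rel _ _ (hf h)
      | refl _ => exact .refl _
      | symm _ _ _ ih => exact ih.symm
      | trans _ _ _ _ _ ih1 ih2 => exact ih1.trans _ _ _ ih2
    let c : Con (FreeSemigroup (IdemE S)) :=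
      { r := fun u v => EqvGen (Step (RedRule X B) (MoveRule X B))
          ((wordList u).map ℓ) ((wordList v).map ℓ)
        iseqv := ⟨fun _ => .refl _, fun h => h.symm, fun h h' => h.trans _ _ _ h'⟩
        mul' := by
          intro u v u' v' h h'
          simp only [wordList_mul, List.map_append]
          exact (happ (· ++ _) (fun h => h.append_right _) h).trans _ _ _
            (happ (_ ++ ·) (fun h => h.append_left _) h') }
    have hle : igCon S ≤ c := by
      refine Con.conGen_le.2 ?_
      rintro _ _ ⟨e, f, g, hef, hg, rfl, rfl⟩
      refine .rel _ _ (Or.inl (.head ⟨?_, hbasic e f g hef hg⟩))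
      change (ℓ g : IG S) = ℓ e * ℓ f
      rw [hℓ, hℓ, hℓ, igBar_of_mul_of hef hg]
    exact HB.criticalPairs.joinable_of_eqvGen (hle (igBar_eq_iff.1 h))
  · have hprod : ∀ u : FreeSemigroup (IdemE S),
        wordProd ((wordList u).map ℓ) = (igBar u : WithOne (IG S)) := by
      intro u
      induction u using FreeSemigroup.recOnMul with
      | ih1 e =>
        change ((ℓ e : IG S) : WithOne (IG S)) * 1 = _
        rw [mul_one, hℓ]
      | ih2 e v ih1 ih2 =>
        rw [igBar_mul, WithOne.coe_mul, ← ih1, ← ih2, wordList_mul, List.map_append]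
        simp only [wordProd, List.map_append, List.prod_append]
    rintro ⟨w, h1, h2⟩
    rw [← WithOne.coe_inj, ← hprod, ← hprod, wordProd_eq_of_steps h1, wordProd_eq_of_steps h2]

end WordProblem

section Decidability

lemma mem_succs_iff {X : Type*} [Finite X] {R : X → X → X → Prop} {T : X → X → X → X → Prop}
    {rl : X → X → List (List X)}
    (hrl : ∀ x y r, r ∈ rl x y ↔ (∃ z, R x y z ∧ r = [z]) ∨ ∃ x' y', T x y x' y' ∧ r = [x', y'])
    (u v : List X) : v ∈ succs rl u ↔ Step R T u v := by
  constructor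
  · intro h
    induction u generalizing v with
    | nil => simp [succs] at h
    | cons x w ih =>
      simp only [succs, List.mem_append, List.mem_flatMap, List.mem_map] at h
      rcases h with ⟨y, hy, r, hr, rfl⟩ | ⟨v, hv, rfl⟩
      · cases w with
        | nil => simp at hy
        | cons z w =>
          obtain rfl : y = z := by simpa using hy
          rcases (hrl _ _ _).1 hr with ⟨z, hz, rfl⟩ | ⟨x', y', h, rfl⟩
          · exact Or.inl (.head hz)
          · exact Or.inr (.head h)
      · exact (ih v hv).cons x
  · have hhead : ∀ x y r w, r ∈ rl x y → r ++ w ∈ succs rl (x :: y :: w) := by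
      intro x y r w hr
      simp only [succs, List.mem_append, List.mem_flatMap, List.mem_map]
      exact Or.inl ⟨y, by simp, r, hr, rfl⟩
    have htail : ∀ x w w', w' ∈ succs rl w → x :: w' ∈ succs rl (x :: w) := by
      intro x w w' h
      rw [succs, List.mem_append, List.mem_map]
      exact Or.inr ⟨w', h, rfl⟩
    rintro (h | h)
    · induction h with
      | head h => exact hhead _ _ [_] _ ((hrl _ _ _).2 (Or.inl ⟨_, h, rfl⟩))
      | tail _ ih => exact htail _ _ _ ih
    · induction h with
      | head h => exact hhead _ _ [_, _] _ ((hrl _ _ _).2 (Or.inr ⟨_, _, h, rfl⟩))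
      | tail _ ih => exact htail _ _ _ ih

lemma primrecPred_joinable_rules {X : Type*} [Finite X] [Primcodable X] (R : X → X → X → Prop)
    (T : X → X → X → X → Prop) : PrimrecPred fun p : List X × List X => Joinable R T p.1 p.2 := by
  classical
  have := Fintype.ofFinite X
  let rl : X → X → List (List X) := fun x y =>
    (Finset.univ.filter fun z => R x y z).toList.map (fun z => [z]) ++
      (Finset.univ.filter fun q : X × X => T x y q.1 q.2).toList.map fun q => [q.1, q.2]
  have hrl : ∀ x y r, r ∈ rl x y ↔
      (∃ z, R x y z ∧ r = [z]) ∨ ∃ x' y', T x y x' y' ∧ r = [x', y'] := by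
    intro x y r
    simp [rl, eq_comm]
  refine (primrecPred_joinable rl ?_).of_eq fun p => ?_
  · intro x y r hr
    rcases (hrl x y r).1 hr with ⟨z, -, rfl⟩ | ⟨x', y', -, rfl⟩ <;> simp
  · simp only [mem_succs_iff hrl]
    rfl

/-- The word problem of the free idempotent generated semigroup of the semigroup of all self-maps
of a finite set `Ω` fixing `K` pointwise is decidable. -/
theorem computablePred_igBar_eq {S Ω : Type*} [Semigroup S] [Finite Ω] (K : Set Ω)
    (ψ : S → Ω → Ω) (hinj : Function.Injective ψ) (hmul : ∀ a b, ψ (a * b) = ψ a ∘ ψ b)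
    (hran : ∀ f, (∃ a, ψ a = f) ↔ ∀ x ∈ K, f x = x) (k : ℕ) (ι : IdemE S ≃ Fin k) :
    ComputablePred fun ab : List (Fin k) × List (Fin k) =>
      ∃ u v : FreeSemigroup (IdemE S),
        encodeWord ι u = ab.1 ∧ encodeWord ι v = ab.2 ∧ igBar u = igBar v := by
  have := Fintype.ofFinite Ω
  obtain ⟨φ, G, H, hG⟩ := exists_idemModel K ψ hinj hmul hran
  obtain ⟨X, B, hX, HB, hGX, hbasic⟩ := H.exists_greenClosed
  have hgood : ∀ e : IdemE S, Good K (ψ e) := by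
    intro e
    refine ⟨(hran _).1 ⟨e, rfl⟩, fun x => ?_⟩
    have := hmul e e
    rw [e.2] at this
    exact (congrFun this x).symm
  let ℓ : IdemE S → X := fun e => ⟨G (ψ e), hGX _ (hgood e)⟩
  have key := igBar_eq_iff_joinable HB ℓ hG (by
    intro e f g hef hg
    have h : RhoOn B (G (ψ e)) (G (ψ e ∘ ψ f)) ∨ LamOn B (G (ψ f)) (G (ψ e ∘ ψ f)) := by
      refine hbasic _ _ (hgood e) (hgood f) ?_
      simpa only [BasicPair, ← hmul, hinj.eq_iff] using hef
    rwa [← hmul, ← hg] at h)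
  have : Finite X := hX
  obtain ⟨m, ⟨ε⟩⟩ := Finite.exists_equiv_fin X
  let _ : Primcodable X := Primcodable.ofEquiv (Fin m) ε
  have hmap : Primrec fun a : List (Fin k) => a.map fun i => ℓ (ι.symm i) :=
    Primrec.list_map Primrec.id ((Primrec.dom_finite fun i => ℓ (ι.symm i)).comp Primrec.snd)
  have hne : PrimrecPred fun a : List (Fin k) => a ≠ [] :=
    (Primrec.eq.comp Primrec.id (Primrec.const [])).not
  have hJ := (primrecPred_joinable_rules (RedRule X B) (MoveRule X B)).comp
    (Primrec.pair (hmap.comp Primrec.fst) (hmap.comp Primrec.snd))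
  refine PrimrecPred.computablePred
    ((((hne.comp Primrec.fst).and (hne.comp Primrec.snd)).and hJ).of_eq fun ab => ?_)
  obtain ⟨a, b⟩ := ab
  have hdec : ∀ a : List (Fin k), a ≠ [] → ∃ u : FreeSemigroup (IdemE S), encodeWord ι u = a := by
    intro a ha
    cases a with
    | nil => exact absurd rfl ha
    | cons i a =>
      exact ⟨⟨ι.symm i, a.map ι.symm⟩, by simp [encodeWord, wordList, Function.comp_def]⟩
  have henc : ∀ u : FreeSemigroup (IdemE S),
      (encodeWord ι u).map (fun i => ℓ (ι.symm i)) = (wordList u).map ℓ := by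
    intro u
    simp [encodeWord, Function.comp_def]
  constructor
  · rintro ⟨⟨ha, hb⟩, h⟩
    obtain ⟨u, rfl⟩ := hdec a ha
    obtain ⟨v, rfl⟩ := hdec b hb
    refine ⟨u, v, rfl, rfl, (key u v).2 ?_⟩
    simpa only [henc] using h
  · rintro ⟨u, v, rfl, rfl, h⟩
    refine ⟨⟨by simp [encodeWord, wordList], by simp [encodeWord, wordList]⟩, ?_⟩
    simpa only [henc] using (key u v).1 h

end Decidability

end IGWord

theorem stmt13 (n : ℕ) (hn : 1 ≤ n) :
    (∀ (k : ℕ) (ι : IdemE (Tn n) ≃ Fin k),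
      ComputablePred (fun ab : List (Fin k) × List (Fin k) =>
        ∃ u v : FreeSemigroup (IdemE (Tn n)),
          encodeWord ι u = ab.1 ∧ encodeWord ι v = ab.2 ∧ igBar u = igBar v)) ∧
    (∀ (k : ℕ) (ι : IdemE (PTn n) ≃ Fin k),
      ComputablePred (fun ab : List (Fin k) × List (Fin k) =>
        ∃ u v : FreeSemigroup (IdemE (PTn n)),
          encodeWord ι u = ab.1 ∧ encodeWord ι v = ab.2 ∧ igBar u = igBar v)) := by
  refine ⟨fun k ι => ?_, fun k ι => ?_⟩
  · refine IGWord.computablePred_igBar_eq (∅ : Set (Fin n)) (fun f : Tn n => (f : Fin n → Fin n))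
      (fun _ _ h => h) (fun _ _ => rfl) (fun f => ?_) k ι
    exact ⟨fun _ x hx => absurd hx (Set.notMem_empty x), fun _ => ⟨f, rfl⟩⟩
  · refine IGWord.computablePred_igBar_eq ({none} : Set (Option (Fin n)))
      (fun f : PTn n => (f.1 : Option (Fin n) → Option (Fin n))) (fun _ _ h => Subtype.ext h)
      (fun _ _ => rfl) (fun f => ?_) k ι
    constructor
    · rintro ⟨a, rfl⟩ x rfl
      exact a.2
    · exact fun h => ⟨⟨f, h none rfl⟩, rfl⟩
end

section
/- For any semigroup S with finite set of idempotents E, the free idempotent generated semigroup IG(E) is weakly abundant (a Fountain semigroup): every element a ∈ IG(E) admits an idempotent ε ∈ IG(E) with a 𝓡̃ ε and an idempotent ε′ ∈ IG(E) with a 𝓛̃ ε′. -/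
section WordSeeds

theorem append_eq_append_cons {α : Type*} {u v A B : List α} {s : α} (h : u ++ v = A ++ s :: B) :
    (∃ B', u = A ++ s :: B' ∧ B = B' ++ v) ∨ (∃ A', v = A' ++ s :: B ∧ A = u ++ A') := by
  rcases List.append_eq_append_iff.1 h with ⟨C, rfl, rfl⟩ | ⟨C, rfl, h'⟩
  · exact Or.inr ⟨C, rfl, rfl⟩
  · cases C with
    | nil => exact Or.inr ⟨[], by simpa using h'.symm, by simp⟩
    | cons a C =>
      simp only [List.cons_append, List.cons.injEq] at h'
      obtain ⟨rfl, rfl⟩ := h'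
      exact Or.inl ⟨C, rfl, rfl⟩

variable {M : Type*} [Monoid M]

/-- Contraction of two adjacent letters `x, y` with `xyx = x` or `yxy = y`. -/
def Contracts (l l' : List M) : Prop :=
  ∃ (u v : List M) (x y : M), (x * y * x = x ∨ y * x * y = y) ∧
    l = u ++ x :: y :: v ∧ l' = u ++ (x * y) :: v

/-- The word `w` has a prefix `A ++ [s]` whose product is 𝓛-related to its last letter `s` and is a
right multiple of `c`. -/
def HasLeftSeed (c : M) (w : List M) : Prop :=
  ∃ (A : List M) (s : M) (B : List M), w = A ++ s :: B ∧
    (∃ t, t * (A.prod * s) = s) ∧ c ∣ A.prod * s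

/-- The word `w` has a letter `s` that is 𝓛-related to the product of the prefix ending in `s` and
𝓡-related to the product of the suffix starting with `s`. -/
def Seeded (w : List M) : Prop :=
  ∃ (A : List M) (s : M) (B : List M), w = A ++ s :: B ∧
    (∃ t, t * (A.prod * s) = s) ∧ ∃ k, s * (B.prod * k) = s

/-- `w` is a concatenation of at most `n` seeded words. -/
inductive SeededBlocks : ℕ → List M → Prop
  | nil : SeededBlocks 0 []
  | cons {n : ℕ} {b w : List M} : Seeded b → SeededBlocks n w → SeededBlocks (n + 1) (b ++ w)
  | skip {n : ℕ} {w : List M} : SeededBlocks n w → SeededBlocks (n + 1) w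

theorem HasLeftSeed.append {c : M} {w : List M} (h : HasLeftSeed c w) (v : List M) :
    HasLeftSeed c (w ++ v) := by
  obtain ⟨A, s, B, rfl, hL, hc⟩ := h
  exact ⟨A, s, B ++ v, by simp, hL, hc⟩

theorem hasLeftSeed_contract_iff {c x y : M} {u v : List M}
    (h : x * y * x = x ∨ y * x * y = y) :
    HasLeftSeed c (u ++ x :: y :: v) ↔ HasLeftSeed c (u ++ (x * y) :: v) := by
  constructor
  · rintro ⟨A, s, B, hw, ⟨t, ht⟩, d, hd⟩
    rcases append_eq_append_cons hw with ⟨B', rfl, rfl⟩ | ⟨A', hv, rfl⟩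
    · exact ⟨A, s, B' ++ (x * y) :: v, by simp, ⟨t, ht⟩, d, hd⟩
    · rcases A' with _ | ⟨a, _ | ⟨b, A'⟩⟩
      · simp only [List.nil_append, List.cons.injEq] at hv
        obtain ⟨rfl, rfl⟩ := hv
        simp only [List.append_nil] at ht hd
        exact ⟨u, _, v, rfl, ⟨t, by grind⟩, d * y, by grind⟩
      · simp only [List.cons_append, List.nil_append, List.cons.injEq] at hv
        obtain ⟨rfl, rfl, rfl⟩ := hv
        simp only [List.prod_append, List.prod_singleton] at ht hd
        exact ⟨u, _, v, rfl, ⟨x * t, by grind⟩, d, by grind⟩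
      · simp only [List.cons_append, List.cons.injEq] at hv
        obtain ⟨rfl, rfl, rfl⟩ := hv
        refine ⟨u ++ (x * y) :: A', s, B, by simp, ⟨t, ?_⟩, d, ?_⟩
        · simpa [mul_assoc] using ht
        · simpa [mul_assoc] using hd
  · rintro ⟨A, s, B, hw, ⟨t, ht⟩, d, hd⟩
    rcases append_eq_append_cons hw with ⟨B', rfl, rfl⟩ | ⟨A', hv, rfl⟩
    · exact ⟨A, s, B' ++ x :: y :: v, by simp, ⟨t, ht⟩, d, hd⟩
    · rcases A' with _ | ⟨a, A'⟩
      · simp only [List.nil_append, List.cons.injEq] at hv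
        obtain ⟨rfl, rfl⟩ := hv
        simp only [List.append_nil] at ht hd
        rcases h with h | h
        · exact ⟨u, x, y :: v, rfl, ⟨t, by grind⟩, d * x, by grind⟩
        · exact ⟨u ++ [x], y, v, by simp, ⟨y * t, by simp; grind⟩, d, by simp; grind⟩
      · simp only [List.cons_append, List.cons.injEq] at hv
        obtain ⟨rfl, rfl⟩ := hv
        refine ⟨u ++ x :: y :: A', s, B, by simp, ⟨t, ?_⟩, d, ?_⟩
        · simpa [mul_assoc] using ht
        · simpa [mul_assoc] using hd

theorem seeded_contract_iff {x y : M} {u v : List M} (h : x * y * x = x ∨ y * x * y = y) :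
    Seeded (u ++ x :: y :: v) ↔ Seeded (u ++ (x * y) :: v) := by
  constructor
  · rintro ⟨A, s, B, hw, ⟨t, ht⟩, k, hk⟩
    rcases append_eq_append_cons hw with ⟨B', rfl, rfl⟩ | ⟨A', hv, rfl⟩
    · exact ⟨A, s, B' ++ (x * y) :: v, by simp, ⟨t, ht⟩, k, by simpa [mul_assoc] using hk⟩
    · rcases A' with _ | ⟨a, _ | ⟨b, A'⟩⟩
      · simp only [List.nil_append, List.cons.injEq] at hv
        obtain ⟨rfl, rfl⟩ := hv
        simp only [List.append_nil, List.prod_cons] at ht hk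
        exact ⟨u, _, v, rfl, ⟨t, by grind⟩, k * y, by grind⟩
      · simp only [List.cons_append, List.nil_append, List.cons.injEq] at hv
        obtain ⟨rfl, rfl, rfl⟩ := hv
        simp only [List.prod_append, List.prod_singleton] at ht hk
        exact ⟨u, _, v, rfl, ⟨x * t, by grind⟩, k, by grind⟩
      · simp only [List.cons_append, List.cons.injEq] at hv
        obtain ⟨rfl, rfl, rfl⟩ := hv
        exact ⟨u ++ (x * y) :: A', s, B, by simp, ⟨t, by simpa [mul_assoc] using ht⟩, k, hk⟩
  · rintro ⟨A, s, B, hw, ⟨t, ht⟩, k, hk⟩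
    rcases append_eq_append_cons hw with ⟨B', rfl, rfl⟩ | ⟨A', hv, rfl⟩
    · exact ⟨A, s, B' ++ x :: y :: v, by simp, ⟨t, ht⟩, k, by simpa [mul_assoc] using hk⟩
    · rcases A' with _ | ⟨a, A'⟩
      · simp only [List.nil_append, List.cons.injEq] at hv
        obtain ⟨rfl, rfl⟩ := hv
        simp only [List.append_nil] at ht hk
        rcases h with h | h
        · exact ⟨u, x, y :: v, rfl, ⟨t, by grind⟩, k * x, by simp; grind⟩
        · exact ⟨u ++ [x], y, v, by simp, ⟨y * t, by simp; grind⟩, k, by grind⟩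
      · simp only [List.cons_append, List.cons.injEq] at hv
        obtain ⟨rfl, rfl⟩ := hv
        exact ⟨u ++ x :: y :: A', s, B, by simp, ⟨t, by simpa [mul_assoc] using ht⟩, k, hk⟩

theorem Seeded.ne_nil {w : List M} (h : Seeded w) : w ≠ [] := by
  obtain ⟨A, s, B, rfl, -⟩ := h
  simp

theorem seeded_contract_split {x y : M} {u v : List M} (h : x * y * x = x ∨ y * x * y = y)
    (hu : Seeded (u ++ [x])) (hv : Seeded (y :: v)) :
    Seeded (u ++ (x * y) :: v) ∨ (Seeded (u ++ [x * y]) ∧ Seeded v) ∨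
      (Seeded u ∧ Seeded ((x * y) :: v)) := by
  obtain ⟨A, s, B, hw, ⟨t, ht⟩, k, hk⟩ := hu
  obtain ⟨A', s', B', hw', ⟨t', ht'⟩, k', hk'⟩ := hv
  rcases append_eq_append_cons hw with ⟨C, rfl, rfl⟩ | ⟨C, hC, rfl⟩
  · simp only [List.prod_append, List.prod_singleton] at hk
    have hu : s * (C.prod * (x * k)) = s := by grind
    rcases A' with _ | ⟨a, A'⟩
    · simp only [List.nil_append, List.cons.injEq] at hw'
      obtain ⟨rfl, rfl⟩ := hw'
      rcases h with h | h
      · exact Or.inl ⟨A, s, C ++ (x * y) :: v, by simp, ⟨t, ht⟩, k' * x * k, by simp; grind⟩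
      · exact Or.inr (Or.inr ⟨⟨A, s, C, rfl, ⟨t, ht⟩, _, hu⟩, [], _, v, rfl, ⟨1, by simp⟩, k',
          by grind⟩)
    · simp only [List.cons_append, List.cons.injEq] at hw'
      obtain ⟨rfl, rfl⟩ := hw'
      simp only [List.prod_cons] at ht'
      rcases h with h | h
      · exact Or.inr (Or.inl ⟨⟨A, s, C ++ [x * y], by simp, ⟨t, ht⟩, x * k, by simp; grind⟩,
          A', s', B', rfl, ⟨t' * y, by grind⟩, k', hk'⟩)
      · exact Or.inr (Or.inr ⟨⟨A, s, C, rfl, ⟨t, ht⟩, _, hu⟩, (x * y) :: A', s', B', rfl,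
          ⟨t' * y, by simp; grind⟩, k', hk'⟩)
  · rcases C with _ | ⟨a, C⟩
    · simp only [List.nil_append, List.cons.injEq] at hC
      obtain ⟨rfl, rfl⟩ := hC
      simp only [List.append_nil] at ht
      rcases A' with _ | ⟨a, A'⟩
      · simp only [List.nil_append, List.cons.injEq] at hw'
        obtain ⟨rfl, rfl⟩ := hw'
        exact Or.inl ⟨u, _, v, rfl, ⟨t, by grind⟩, k', by grind⟩
      · simp only [List.cons_append, List.cons.injEq] at hw'
        obtain ⟨rfl, rfl⟩ := hw'
        simp only [List.prod_cons] at ht'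
        rcases h with h | h
        · exact Or.inr (Or.inl ⟨⟨u, _, [], rfl, ⟨t, by grind⟩, 1, by simp⟩,
            A', s', B', rfl, ⟨t' * y, by grind⟩, k', hk'⟩)
        · exact Or.inl ⟨u ++ (x * y) :: A', s', B', by simp, ⟨t' * y * t, by simp; grind⟩, k', hk'⟩
    · simp at hC

theorem SeededBlocks.cons_word {n : ℕ} {y : M} {v : List M} (h : SeededBlocks n (y :: v)) :
    ∃ (m : ℕ) (b w : List M), n = m + 1 ∧ v = b ++ w ∧ Seeded (y :: b) ∧ SeededBlocks m w := by
  generalize hl : y :: v = l at h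
  induction h with
  | nil => simp at hl
  | @cons m b w hb hw _ =>
    rcases b with _ | ⟨a, b⟩
    · exact absurd rfl hb.ne_nil
    · simp only [List.cons_append, List.cons.injEq] at hl
      obtain ⟨rfl, rfl⟩ := hl
      exact ⟨m, b, w, rfl, rfl, hb, hw⟩
  | skip _ ih =>
    obtain ⟨m, b, w, rfl, h1, h2, h3⟩ := ih hl
    exact ⟨m + 1, b, w, rfl, h1, h2, h3.skip⟩

theorem SeededBlocks.contract {n : ℕ} {x y : M} {u v : List M}
    (h : x * y * x = x ∨ y * x * y = y) (hw : SeededBlocks n (u ++ x :: y :: v)) :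
    SeededBlocks n (u ++ (x * y) :: v) := by
  generalize hl : u ++ x :: y :: v = l at hw
  induction hw generalizing u with
  | nil => simp at hl
  | @cons m b w hb hw ih =>
    rcases append_eq_append_cons hl.symm with ⟨B, rfl, hB⟩ | ⟨A, rfl, rfl⟩
    · rcases List.cons_eq_append_iff.1 hB with ⟨rfl, rfl⟩ | ⟨B, rfl, rfl⟩
      · obtain ⟨m, b, w, rfl, rfl, hb', hw'⟩ := hw.cons_word
        rcases seeded_contract_split h hb hb' with h1 | ⟨h1, h2⟩ | ⟨h1, h2⟩
        · simpa using (SeededBlocks.cons h1 hw').skip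
        · simpa using SeededBlocks.cons h1 (SeededBlocks.cons h2 hw')
        · simpa using SeededBlocks.cons h1 (SeededBlocks.cons h2 hw')
      · simpa using SeededBlocks.cons ((seeded_contract_iff h).1 hb) hw
    · simpa using SeededBlocks.cons hb (ih rfl)
  | skip _ ih => exact (ih hl).skip

theorem SeededBlocks.expand {n : ℕ} {x y : M} {u v : List M}
    (h : x * y * x = x ∨ y * x * y = y) (hw : SeededBlocks n (u ++ (x * y) :: v)) :
    SeededBlocks n (u ++ x :: y :: v) := by
  generalize hl : u ++ (x * y) :: v = l at hw
  induction hw generalizing u with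
  | nil => simp at hl
  | @cons m b w hb hw ih =>
    rcases append_eq_append_cons hl.symm with ⟨B, rfl, rfl⟩ | ⟨A, rfl, rfl⟩
    · simpa using SeededBlocks.cons ((seeded_contract_iff h).2 hb) hw
    · simpa using SeededBlocks.cons hb (ih rfl)
  | skip _ ih => exact (ih hl).skip

theorem seededBlocks_length (w : List M) : SeededBlocks w.length w := by
  induction w with
  | nil => exact .nil
  | cons a w ih => exact .cons (b := [a]) ⟨[], a, [], rfl, ⟨1, by simp⟩, 1, by simp⟩ ih

theorem Relation.EqvGen.iff_of_forall {α : Type*} {r : α → α → Prop} {P : α → Prop}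
    (hP : ∀ a b, r a b → (P a ↔ P b)) {a b : α} (h : Relation.EqvGen r a b) : P a ↔ P b := by
  induction h with
  | rel a b h => exact hP a b h
  | refl => exact Iff.rfl
  | symm _ _ _ ih => exact ih.symm
  | trans _ _ _ _ _ h1 h2 => exact h1.trans h2

/-- The congruence on words generated by contractions. -/
abbrev WordEqv : List M → List M → Prop := Relation.EqvGen Contracts

theorem WordEqv.append {a b : List M} (h : WordEqv a b) (u v : List M) :
    WordEqv (u ++ a ++ v) (u ++ b ++ v) := by
  induction h with
  | rel a b h =>
    obtain ⟨u', v', x, y, hxy, rfl, rfl⟩ := h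
    exact .rel _ _ ⟨u ++ u', v' ++ v, x, y, hxy, by simp, by simp⟩
  | refl => exact .refl _
  | symm _ _ _ ih => exact .symm _ _ ih
  | trans _ _ _ _ _ h1 h2 => exact .trans _ _ _ h1 h2

theorem WordEqv.hasLeftSeed_iff {c : M} {a b : List M} (h : WordEqv a b) :
    HasLeftSeed c a ↔ HasLeftSeed c b := by
  refine Relation.EqvGen.iff_of_forall (P := HasLeftSeed c) ?_ h
  rintro _ _ ⟨u, v, x, y, hxy, rfl, rfl⟩
  exact hasLeftSeed_contract_iff hxy

theorem WordEqv.seededBlocks_iff {n : ℕ} {a b : List M} (h : WordEqv a b) :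
    SeededBlocks n a ↔ SeededBlocks n b := by
  refine Relation.EqvGen.iff_of_forall (P := SeededBlocks n) ?_ h
  rintro _ _ ⟨u, v, x, y, hxy, rfl, rfl⟩
  exact ⟨.contract hxy, .expand hxy⟩

theorem WordEqv.prod_eq {a b : List M} (h : WordEqv a b) : a.prod = b.prod := by
  induction h with
  | rel a b h =>
    obtain ⟨u, v, x, y, -, rfl, rfl⟩ := h
    simp [mul_assoc]
  | refl => rfl
  | symm _ _ _ ih => exact ih.symm
  | trans _ _ _ _ _ h1 h2 => exact h1.trans h2

theorem wordEqv_flatten_replicate {h : List M} (hh : WordEqv (h ++ h) h) (n : ℕ) :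
    WordEqv (List.replicate (n + 1) h).flatten h := by
  induction n with
  | zero => simpa using Relation.EqvGen.refl h
  | succ n ih =>
    rw [List.replicate_succ, List.flatten_cons]
    exact .trans _ _ _ (by simpa using WordEqv.append ih h []) hh

/-- A seeded block containing a full copy of a word `h` with idempotent product `η` yields a left
seed divisible by `η`. -/
theorem hasLeftSeed_of_seeded {h X D D' Y : List M} (hh : h.prod * h.prod = h.prod)
    (hX : (X ++ D).prod * h.prod = h.prod) (hs : Seeded (D ++ h ++ D')) :
    HasLeftSeed h.prod (X ++ (D ++ h ++ D') ++ Y) := by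
  obtain ⟨A, s, B, hw, ⟨t, ht⟩, k, hk⟩ := hs
  rw [hw]
  rw [List.prod_append] at hX
  suffices H : (∃ t, t * ((X ++ A).prod * s) = s) ∧ h.prod ∣ (X ++ A).prod * s from
    ⟨X ++ A, s, B ++ Y, by simp, H⟩
  rcases append_eq_append_cons hw with ⟨B', hw', rfl⟩ | ⟨A', rfl, rfl⟩
  · rcases append_eq_append_cons hw' with ⟨C, rfl, rfl⟩ | ⟨A', rfl, rfl⟩
    · simp only [List.prod_append, List.prod_cons] at hk hX ⊢
      have hq : X.prod * A.prod * s = h.prod * (D'.prod * k) := by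
        rw [← hX]
        simp only [mul_assoc] at hk ⊢
        rw [hk]
      exact ⟨⟨s * C.prod * h.prod, by grind⟩, _, hq⟩
    · simp only [List.prod_append, List.prod_cons] at hk hX ht hh ⊢
      have hq : X.prod * (D.prod * A'.prod) * s = A'.prod * (s * B'.prod) * (D'.prod * k) := by
        have := congrArg (· * (D'.prod * k)) hX
        grind
      exact ⟨⟨t * D.prod, by grind⟩, _, hq⟩
  · simp only [List.prod_append] at ht hX ⊢
    exact ⟨⟨t * D.prod, by grind⟩, A'.prod * s, by grind⟩

theorem hasLeftSeed_of_seededBlocks {h : List M} (hne : h ≠ []) (hh : h.prod * h.prod = h.prod)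
    {n : ℕ} {X D : List M} (hX : (X ++ D).prod * h.prod = h.prod)
    (hb : SeededBlocks n (D ++ (List.replicate (n + 1) h).flatten)) :
    HasLeftSeed h.prod (X ++ (D ++ (List.replicate (n + 1) h).flatten)) := by
  generalize hl : D ++ (List.replicate (n + 1) h).flatten = l at hb
  induction hb generalizing X D with
  | nil => simp_all
  | @cons n b w hb hw ih =>
    rw [List.replicate_succ, List.flatten_cons, ← List.append_assoc] at hl
    rcases List.append_eq_append_iff.1 hl with ⟨C, rfl, hC⟩ | ⟨C, hC, rfl⟩
    · rw [← List.append_assoc]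
      exact hasLeftSeed_of_seeded hh hX hb
    · rw [← List.append_assoc]
      refine ih (D := C) ?_ rfl
      rw [List.append_assoc, ← hC, ← List.append_assoc, List.prod_append, mul_assoc, hh, hX]
  | @skip n w hw ih =>
    rw [List.replicate_succ, List.flatten_cons, ← List.append_assoc] at hl
    subst hl
    exact ih (X := X) (D := D ++ h) (by
      rw [← List.append_assoc, List.prod_append, mul_assoc, hh, hX]) rfl

/-- An idempotent word has a left seed that is 𝓡-related to it. -/
theorem hasLeftSeed_of_idempotent {h : List M} (hne : h ≠ []) (hh : WordEqv (h ++ h) h) :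
    HasLeftSeed h.prod h := by
  have hr := wordEqv_flatten_replicate hh h.length
  rw [← hr.hasLeftSeed_iff]
  exact hasLeftSeed_of_seededBlocks (X := []) (D := []) hne (by simpa using hh.prod_eq) (by simp)
    (hr.seededBlocks_iff.2 (seededBlocks_length h))

theorem hasLeftSeed_of_wordEqv_append {h w : List M} (hne : h ≠ []) (hh : WordEqv (h ++ h) h)
    (hw : WordEqv (h ++ w) w) : HasLeftSeed h.prod w :=
  hw.hasLeftSeed_iff.1 ((hasLeftSeed_of_idempotent hne hh).append w)

/-- The product of the longest prefix which is a left seed lies 𝓡-below all other left seeds. -/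
theorem exists_minimal_leftSeed {w : List M} (hne : w ≠ []) :
    ∃ (A : List M) (s : M) (B : List M), w = A ++ s :: B ∧ (∃ t, t * (A.prod * s) = s) ∧
      ∀ c, HasLeftSeed c w → c ∣ A.prod * s := by
  induction w using List.reverseRecOn with
  | nil => exact absurd rfl hne
  | append_singleton l a ih =>
    by_cases ha : ∃ t, t * (l.prod * a) = a
    · refine ⟨l, a, [], rfl, ha, ?_⟩
      rintro c ⟨A, s, B, hw, -, hc⟩
      have : l.prod * a = (A.prod * s) * B.prod := by
        simpa [mul_assoc] using congrArg List.prod hw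
      exact this ▸ hc.mul_right _
    · have hl : l ≠ [] := by
        rintro rfl
        exact ha ⟨1, by simp⟩
      obtain ⟨A, s, B, rfl, hs, hmin⟩ := ih hl
      refine ⟨A, s, B ++ [a], by simp, hs, ?_⟩
      rintro c ⟨A', s', B', hw, hs', hc⟩
      rcases append_eq_append_cons hw with ⟨C, h1, rfl⟩ | ⟨C, h1, rfl⟩
      · exact hmin c ⟨A', s', C, h1, hs', hc⟩
      · rcases C with _ | ⟨_, C⟩
        · simp only [List.nil_append, List.cons.injEq] at h1
          obtain ⟨rfl, rfl⟩ := h1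
          exact absurd (by simpa using hs') ha
        · simp at h1

theorem exists_regular_left_divisor {w : List M} (hne : w ≠ []) (hidem : ∀ s ∈ w, s * s = s) :
    ∃ (A : List M) (s : M) (t r : M), s ∈ w ∧ w.prod = A.prod * s * r ∧
      A.prod * s * t * (A.prod * s) = A.prod * s ∧
      ∀ h : List M, h ≠ [] → WordEqv (h ++ h) h → WordEqv (h ++ w) w →
        h.prod * (A.prod * s) = A.prod * s := by
  obtain ⟨A, s, B, rfl, ⟨t, ht⟩, hmin⟩ := exists_minimal_leftSeed hne
  refine ⟨A, s, t, B.prod, by simp, by simp [mul_assoc], ?_, ?_⟩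
  · rw [mul_assoc, ht, mul_assoc, hidem s (by simp)]
  · intro h hh hi hw
    obtain ⟨d, hd⟩ := hmin _ (hasLeftSeed_of_wordEqv_append hh hi hw)
    rw [hd, ← mul_assoc, ← List.prod_append, hi.prod_eq]

open MulOpposite in
theorem WordEqv.op_reverse {a b : List M} (h : WordEqv a b) :
    WordEqv (a.map op).reverse (b.map op).reverse := by
  induction h with
  | rel a b h =>
    obtain ⟨u, v, x, y, hxy, rfl, rfl⟩ := h
    refine .rel _ _ ⟨(v.map op).reverse, (u.map op).reverse, op y, op x, ?_, by simp, by simp⟩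
    simp only [← op_mul, op_inj, ← mul_assoc]
    exact hxy.symm
  | refl => exact .refl _
  | symm _ _ _ ih => exact .symm _ _ ih
  | trans _ _ _ _ _ h1 h2 => exact .trans _ _ _ h1 h2

end WordSeeds

section IGWords

variable {S : Type*} [Semigroup S]

/-- The letter `e` of a word as an element of `IG(E)¹`. -/
def igLetter (e : IdemE S) : WithOne (IG S) := (igBar (FreeSemigroup.of e) : IG S)

/-- The list of the letters of a word as elements of `IG(E)¹`. -/
def igWord (w : FreeSemigroup (IdemE S)) : List (WithOne (IG S)) := (wordList w).map igLetter

theorem igBar_mul (w w' : FreeSemigroup (IdemE S)) : igBar (w * w') = igBar w * igBar w' := rfl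

theorem igBar_surjective : Function.Surjective (igBar (S := S)) := Quotient.mk_surjective

theorem igBar_of_mul_of {e f g : IdemE S} (h : BasicPair e f) (hg : (g : S) = e * f) :
    igBar (FreeSemigroup.of e) * igBar (FreeSemigroup.of f) = igBar (FreeSemigroup.of g) :=
  (Con.eq _).2 (Con.le_conGen _ _ ⟨e, f, g, h, hg, rfl, rfl⟩)

theorem igLetter_mul {e f g : IdemE S} (h : BasicPair e f) (hg : (g : S) = e * f) :
    igLetter e * igLetter f = igLetter g := by
  simp only [igLetter, ← WithOne.coe_mul, igBar_of_mul_of h hg]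

theorem igLetter_mul_self (e : IdemE S) : igLetter e * igLetter e = igLetter e :=
  igLetter_mul (.inl e.2) e.2.symm

theorem BasicPair.symm {e f : IdemE S} (h : BasicPair e f) : BasicPair f e := by
  unfold BasicPair at *
  tauto

theorem BasicPair.igLetter_mul_mul {e f : IdemE S} (h : BasicPair e f) :
    igLetter e * igLetter f * igLetter e = igLetter e ∨
      igLetter f * igLetter e * igLetter f = igLetter f := by
  rcases id h with h1 | h1 | h1 | h1
  · left
    rw [igLetter_mul h h1.symm, igLetter_mul_self]
  · right
    rw [mul_assoc, igLetter_mul h h1.symm, igLetter_mul_self]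
  · left
    rw [mul_assoc, igLetter_mul h.symm h1.symm, igLetter_mul_self]
  · right
    rw [igLetter_mul h.symm h1.symm, igLetter_mul_self]

theorem igWord_mul (w w' : FreeSemigroup (IdemE S)) : igWord (w * w') = igWord w ++ igWord w' := by
  simp [igWord, wordList]

theorem igWord_ne_nil (w : FreeSemigroup (IdemE S)) : igWord w ≠ [] := by
  simp [igWord, wordList]

theorem prod_igWord (w : FreeSemigroup (IdemE S)) : (igWord w).prod = (igBar w : IG S) := by
  induction w using FreeSemigroup.recOnMul with
  | ih1 e => simp [igWord, wordList, igLetter, FreeSemigroup.of]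
  | ih2 e w h1 h2 => rw [igWord_mul, List.prod_append, h1, h2, igBar_mul, WithOne.coe_mul]

theorem wordEqv_igWord {w w' : FreeSemigroup (IdemE S)} (h : igBar w = igBar w') :
    WordEqv (igWord w) (igWord w') := by
  let c : Con (FreeSemigroup (IdemE S)) :=
    { r := fun w w' => WordEqv (igWord w) (igWord w')
      iseqv := ⟨fun _ => .refl _, .symm _ _, .trans _ _ _⟩
      mul' := fun {a b a' b'} h h' => by
        rw [igWord_mul, igWord_mul]
        exact .trans _ _ _ (by simpa using WordEqv.append h [] (igWord a'))
          (by simpa using WordEqv.append h' (igWord b) []) }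
  refine (Con.conGen_le (c := c)).2 ?_ ((Con.eq _).1 h)
  rintro _ _ ⟨e, f, g, hb, hg, rfl, rfl⟩
  refine .rel _ _ ⟨[], [], igLetter e, igLetter f, hb.igLetter_mul_mul, ?_, ?_⟩
  · simp [igWord, wordList, FreeSemigroup.of]
  · simp [igWord, wordList, FreeSemigroup.of, igLetter_mul hb hg]

theorem exists_coe_of_mem_igWord {w : FreeSemigroup (IdemE S)} {s : WithOne (IG S)}
    (hs : s ∈ igWord w) : s * s = s ∧ ∃ b : IG S, s = b := by
  obtain ⟨e, -, rfl⟩ := List.mem_map.1 hs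
  exact ⟨igLetter_mul_self e, _, rfl⟩

end IGWords

theorem WithOne.exists_mul_coe {T : Type*} [Semigroup T] (x : WithOne T) (b : T) :
    ∃ c : T, x * b = c := by
  cases x with
  | one => exact ⟨b, one_mul _⟩
  | coe x => exact ⟨x * b, rfl⟩

theorem WithOne.exists_coe_mul {T : Type*} [Semigroup T] (b : T) (x : WithOne T) :
    ∃ c : T, (b : WithOne T) * x = c := by
  cases x with
  | one => exact ⟨b, mul_one _⟩
  | coe x => exact ⟨b * x, rfl⟩

theorem exists_idempotent_rTilde {S : Type*} [Semigroup S] (a : IG S) :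
    ∃ ε : IG S, ε * ε = ε ∧ RTilde a ε := by
  obtain ⟨w, rfl⟩ := igBar_surjective a
  obtain ⟨A, s, t, r, hs, hw, hp, hmin⟩ := exists_regular_left_divisor (igWord_ne_nil w)
    fun s hs => (exists_coe_of_mem_igWord hs).1
  obtain ⟨-, b, rfl⟩ := exists_coe_of_mem_igWord hs
  obtain ⟨p, hpc⟩ := WithOne.exists_mul_coe A.prod b
  rw [hpc] at hw hp hmin
  obtain ⟨ε, hε⟩ := WithOne.exists_coe_mul p t
  have hεp : (ε : WithOne (IG S)) * p = p := hε ▸ hp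
  have hεw : ε * igBar w = igBar w := by
    rw [← WithOne.coe_inj, WithOne.coe_mul, ← prod_igWord, hw, ← mul_assoc, hεp]
  refine ⟨ε, ?_, fun η hη => ⟨fun h => ?_, fun h => ?_⟩⟩
  · rw [← WithOne.coe_inj, WithOne.coe_mul]
    nth_rw 2 [← hε]
    rw [← mul_assoc, hεp, hε]
  · obtain ⟨v, rfl⟩ := igBar_surjective η
    have := hmin (igWord v) (igWord_ne_nil v)
      (igWord_mul v v ▸ wordEqv_igWord ((igBar_mul v v).trans hη))
      (igWord_mul v w ▸ wordEqv_igWord ((igBar_mul v w).trans h))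
    rw [← WithOne.coe_inj, WithOne.coe_mul, ← hε, ← mul_assoc, ← prod_igWord, this]
  · rw [← hεw, ← mul_assoc, h]

open MulOpposite in
theorem exists_idempotent_lTilde {S : Type*} [Semigroup S] (a : IG S) :
    ∃ ε : IG S, ε * ε = ε ∧ LTilde a ε := by
  obtain ⟨w, rfl⟩ := igBar_surjective a
  obtain ⟨A, s, t, r, hs, hw, hp, hmin⟩ := exists_regular_left_divisor
    (w := ((igWord w).map op).reverse) (by simpa using igWord_ne_nil w) (by
      simp only [List.mem_reverse, List.mem_map, forall_exists_index, and_imp]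
      rintro _ s hs rfl
      rw [← op_mul, (exists_coe_of_mem_igWord hs).1])
  simp only [List.mem_reverse, List.mem_map] at hs
  obtain ⟨s, hs, rfl⟩ := hs
  obtain ⟨-, b, rfl⟩ := exists_coe_of_mem_igWord hs
  obtain ⟨p, hpc⟩ := WithOne.exists_coe_mul b A.prod.unop
  replace hpc : A.prod * op (b : WithOne (IG S)) = op (p : WithOne (IG S)) := unop_injective hpc
  have hprod (v : FreeSemigroup (IdemE S)) :
      ((igWord v).map op).reverse.prod = op (igBar v : WithOne (IG S)) := by
    rw [← prod_igWord, op_list_prod]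
  rw [hpc] at hw hp hmin
  rw [hprod] at hw
  replace hw := congrArg unop hw
  replace hp := congrArg unop hp
  simp only [unop_mul, unop_op] at hw hp
  obtain ⟨ε, hε⟩ := WithOne.exists_mul_coe t.unop p
  have hεp : (p : WithOne (IG S)) * ε = p := hε ▸ hp
  have hεw : igBar w * ε = igBar w := by
    rw [← WithOne.coe_inj, WithOne.coe_mul, hw, mul_assoc, hεp]
  refine ⟨ε, ?_, fun η hη => ⟨fun h => ?_, fun h => ?_⟩⟩
  · rw [← WithOne.coe_inj, WithOne.coe_mul]
    nth_rw 1 [← hε]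
    rw [mul_assoc, hεp, hε]
  · obtain ⟨v, rfl⟩ := igBar_surjective η
    have key (u u' : FreeSemigroup (IdemE S)) (h : igBar u * igBar u' = igBar u) :
        WordEqv (((igWord u').map op).reverse ++ ((igWord u).map op).reverse)
          ((igWord u).map op).reverse := by
      have := (wordEqv_igWord ((igBar_mul u u').trans h)).op_reverse
      rwa [igWord_mul, List.map_append, List.reverse_append] at this
    have := hmin _ (by simpa using igWord_ne_nil v) (key v v hη) (key w v h)
    rw [hprod, ← op_mul, op_inj] at this
    rw [← WithOne.coe_inj, WithOne.coe_mul, ← hε, mul_assoc, this]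
  · rw [← hεw, mul_assoc, h]

theorem stmt14 {S : Type*} [Semigroup S] [Finite (IdemE S)] (a : IG S) :
    (∃ ε : IG S, ε * ε = ε ∧ RTilde a ε) ∧
    (∃ ε' : IG S, ε' * ε' = ε' ∧ LTilde a ε') := by
  exact ⟨exists_idempotent_rTilde a, exists_idempotent_lTilde a⟩
end
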